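/- Let g : D^n → ℂ be a good inner function on the unit polydisk and let φ : D^n → D^n be an automorphism of the polydisk (a biholomorphic self-map). Then the composition g ∘ φ is again a good inner function on D^n. -/

import Mathlib

open MeasureTheory Filter Set

noncomputable section

/-- The open unit polydisk in `ℂ^n`. -/
def polydisk (n : ℕ) : Set (Fin n → ℂ) := {z | ∀ i, ‖z i‖ < 1}

/-- The closed unit polydisk in `ℂ^n`. -/
def closedPolydisk (n : ℕ) : Set (Fin n → ℂ) := {z | ∀ i, ‖z i‖ ≤ 1}

/-- Holomorphic on the polydisk. -/
def HoloOnPolydisk {n : ℕ} (f : (Fin n → ℂ) → ℂ) : Prop :=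
  DifferentiableOn ℂ f (polydisk n)

/-- Membership in the closed unit ball of `H^∞(𝔻^n)`. -/
def InBallHinf {n : ℕ} (f : (Fin n → ℂ) → ℂ) : Prop :=
  HoloOnPolydisk f ∧ ∀ z ∈ polydisk n, ‖f z‖ ≤ 1

/-- A bounded holomorphic function on the polydisk is inner if its radial limits
have modulus one almost everywhere. -/
def IsInnerFn {n : ℕ} (f : (Fin n → ℂ) → ℂ) : Prop :=
  HoloOnPolydisk f ∧ (∃ M : ℝ, ∀ z ∈ polydisk n, ‖f z‖ ≤ M) ∧
    ∀ᵐ θ : Fin n → ℝ,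
      Tendsto (fun r : ℝ => ‖f (fun i => (r : ℂ) * Complex.exp (Complex.I * (θ i : ℂ)))‖)
        (nhdsWithin 1 (Set.Iio 1)) (nhds 1)

/-- A good inner function: the means of `log |f|` over the distinguished boundary
(normalized Haar measure) tend to `0` as `r → 1⁻`. -/
def IsGoodInnerFn {n : ℕ} (f : (Fin n → ℂ) → ℂ) : Prop :=
  IsInnerFn f ∧
    Tendsto (fun r : ℝ => (2 * Real.pi)⁻¹ ^ n *
        ∫ θ in Set.pi Set.univ (fun _ : Fin n => Set.Ico (0 : ℝ) (2 * Real.pi)),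
          Real.log ‖f (fun i => (r : ℂ) * Complex.exp (Complex.I * (θ i : ℂ)))‖)
      (nhdsWithin 1 (Set.Iio 1)) (nhds 0)

/-- An automorphism of the polydisk: a holomorphic bijective self-map of `𝔻^n`
with holomorphic inverse. -/
def IsPolydiskAutomorphism {n : ℕ} (φ : (Fin n → ℂ) → (Fin n → ℂ)) : Prop :=
  Set.MapsTo φ (polydisk n) (polydisk n) ∧
  (∀ i, DifferentiableOn ℂ (fun z => φ z i) (polydisk n)) ∧
  ∃ ψ : (Fin n → ℂ) → (Fin n → ℂ),
    Set.MapsTo ψ (polydisk n) (polydisk n) ∧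
    (∀ i, DifferentiableOn ℂ (fun z => ψ z i) (polydisk n)) ∧
    (∀ z ∈ polydisk n, ψ (φ z) = z) ∧ (∀ z ∈ polydisk n, φ (ψ z) = z)

open Metric Real Complex in
lemma log_norm_sub_le_circleAverage {r : ℝ} {u w : ℂ} (hu : u ∈ closedBall 0 r)
    (hw : w ∈ ball 0 r) (hwu : w ≠ u) :
    Real.log ‖w - u‖ ≤ circleAverage (poissonKernel 0 w * (Real.log ‖· - u‖)) 0 r := by
  have hr : 0 < r := by
    have := norm_nonneg w
    rw [mem_ball_zero_iff] at hw; linarith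
  rw [mem_closedBall_zero_iff] at hu
  rcases hu.eq_or_lt with h | h
  · rw [poissonKernel_eq_re_herglotzRieszKernel,
      circleAverage_re_herglotzRieszKernel_mul_log (by simp [h]) hw]
  rw [mem_ball_zero_iff] at hw
  set k : ℂ → ℂ := fun z => (r - (starRingEnd ℂ u / r) * z)
  have hrc : (r : ℂ) ≠ 0 := by exact_mod_cast hr.ne'
  have hk0 : ∀ z ∈ closedBall (0 : ℂ) r, k z ≠ 0 := by
    intro z hz h0
    rw [mem_closedBall_zero_iff] at hz
    have h1 : (r : ℂ) = (starRingEnd ℂ u / r) * z := sub_eq_zero.1 h0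
    have h2 := congrArg norm h1
    rw [norm_mul, norm_div, RCLike.norm_conj, Complex.norm_real, Real.norm_of_nonneg hr.le] at h2
    have h3 : ‖u‖ / r < 1 := (div_lt_one hr).2 h
    have h4 : 0 ≤ ‖u‖ / r := by positivity
    nlinarith
  have hharm : InnerProductSpace.HarmonicOnNhd (fun z => Real.log ‖k z‖) (closedBall 0 r) := by
    intro z hz
    refine AnalyticAt.harmonicAt_log_norm ?_ (hk0 z hz)
    fun_prop
  have hmean := hharm.circleAverage_poissonKernel_smul (mem_ball_zero_iff.2 hw)
  have hcong : circleAverage (poissonKernel 0 w * (Real.log ‖· - u‖)) 0 r =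
      circleAverage (poissonKernel 0 w • fun z => Real.log ‖k z‖) 0 r := by
    refine circleAverage_congr_sphere fun z hz => ?_
    rw [abs_of_pos hr, mem_sphere_zero_iff_norm] at hz
    have : ‖k z‖ = ‖z - u‖ := by
      have h1 : k z = (z / r) * starRingEnd ℂ (z - u) := by
        have : z * starRingEnd ℂ z = r ^ 2 := by
          rw [Complex.mul_conj, Complex.normSq_eq_norm_sq, hz]; push_cast; rfl
        simp only [k, map_sub]
        field_simp
        linear_combination -this
      rw [h1, norm_mul, norm_div, hz, RCLike.norm_conj, Complex.norm_real,
        Real.norm_of_nonneg hr.le, div_self hr.ne', one_mul]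
    simp [this]
  rw [hcong, hmean]
  refine Real.log_le_log (norm_pos_iff.2 (sub_ne_zero.2 hwu)) ?_
  have h1 : ‖w - u‖ ^ 2 ≤ ‖k w‖ ^ 2 := by
    have e : ‖k w‖ ^ 2 - ‖w - u‖ ^ 2 = (r ^ 2 - ‖w‖ ^ 2) * (r ^ 2 - ‖u‖ ^ 2) / r ^ 2 := by
      simp only [k, ← Complex.normSq_eq_norm_sq, Complex.normSq_apply]
      simp
      field_simp
      ring
    have : 0 ≤ (r ^ 2 - ‖w‖ ^ 2) * (r ^ 2 - ‖u‖ ^ 2) / r ^ 2 := by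
      have a1 : ‖w‖ ^ 2 ≤ r ^ 2 := by gcongr
      have a2 : ‖u‖ ^ 2 ≤ r ^ 2 := by gcongr
      have := sub_nonneg.2 a1
      have := sub_nonneg.2 a2
      positivity
    linarith
  exact le_of_sq_le_sq h1 (norm_nonneg _)

open Metric Real Complex in
lemma continuous_poissonKernel_circleMap {r : ℝ} {w : ℂ} (hw : w ∈ ball 0 r) :
    Continuous fun t : ℝ => poissonKernel 0 w (circleMap 0 r t) := by
  rw [mem_ball_zero_iff] at hw
  have hr : 0 < r := (norm_nonneg w).trans_lt hw
  unfold poissonKernel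
  refine Continuous.div (by fun_prop) (by fun_prop) fun t h0 => ?_
  have : circleMap 0 r t = w := by
    simpa [sub_eq_zero] using h0
  rw [← this, norm_circleMap_zero, abs_of_pos hr] at hw
  exact lt_irrefl _ hw

open Metric Real Complex in
lemma circleIntegrable_poissonKernel_mul {r : ℝ} {w : ℂ} (hw : w ∈ ball 0 r) {q : ℂ → ℝ}
    (hq : CircleIntegrable q 0 r) : CircleIntegrable (poissonKernel 0 w * q) 0 r :=
  IntervalIntegrable.continuousOn_mul hq (continuous_poissonKernel_circleMap hw).continuousOn

open Metric Real Complex MeromorphicOn in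
theorem log_norm_le_circleAverage_poissonKernel {r : ℝ} {w : ℂ} {F : ℂ → ℂ}
    (hF : AnalyticOnNhd ℂ F (closedBall 0 r)) (hw : w ∈ ball 0 r) (hFw : F w ≠ 0) :
    Real.log ‖F w‖ ≤ circleAverage (poissonKernel 0 w * (Real.log ‖F ·‖)) 0 r := by
  have hr : 0 < r := by
    have := norm_nonneg w
    rw [mem_ball_zero_iff] at hw; linarith
  have hwc := ball_subset_closedBall hw
  have hord : ∀ u : closedBall (0 : ℂ) r, meromorphicOrderAt F u ≠ ⊤ := by
    rw [← hF.meromorphicOn.exists_meromorphicOrderAt_ne_top_iff_forall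
      (Metric.isConnected_closedBall hr.le)]
    refine ⟨⟨w, hwc⟩, ?_⟩
    rw [(hF w hwc).meromorphicNFAt.meromorphicOrderAt_eq_zero_iff.2 hFw]
    simp
  set D := divisor F (closedBall 0 r)
  have hfin : D.support.Finite := D.finiteSupport (isCompact_closedBall 0 r)
  obtain ⟨g, hg, hg0, hfg⟩ := hF.meromorphicOn.extract_zeros_poles hord hfin
  have hD0 : ∀ u, 0 ≤ D u := fun u => hF.divisor_nonneg u
  have hlog := extract_zeros_poles_log hg0 hfg
  have hsum : (∑ᶠ u, (fun z : ℂ => (D u : ℝ) * Real.log ‖z - u‖)) =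
      ∑ u ∈ hfin.toFinset, (fun z : ℂ => (D u : ℝ) * Real.log ‖z - u‖) := by
    rw [finsum_eq_sum_of_support_subset]
    intro u
    contrapose
    intro hu
    have : D u = 0 := by simpa using hu
    simp [this]; rfl
  have hlog' : (fun z => Real.log ‖F z‖) =ᶠ[codiscreteWithin (closedBall 0 r)]
      (∑ u ∈ hfin.toFinset, (fun z : ℂ => (D u : ℝ) * Real.log ‖z - u‖)) +
        (fun z => Real.log ‖g z‖) := by
    rw [← hsum]; exact hlog
  have hDw : D w = 0 := by
    simp only [D]
    rw [hF.divisor_apply hwc, (hF w hwc).analyticOrderAt_eq_zero.mpr hFw]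
    rfl
  have hne : ∀ u ∈ hfin.toFinset, w ≠ u := by
    rintro u hu rfl
    simp [hDw] at hu
  have hmem : ∀ u ∈ hfin.toFinset, u ∈ closedBall (0 : ℂ) r := fun u hu =>
    D.supportWithinDomain (by simpa using hu)
  have hgw := hg0 ⟨w, hwc⟩
  -- equality at `w`
  have hev : (fun z => Real.log ‖F z‖) =ᶠ[nhdsWithin w {w}ᶜ]
      (∑ u ∈ hfin.toFinset, (fun z : ℂ => (D u : ℝ) * Real.log ‖z - u‖)) +
        (fun z => Real.log ‖g z‖) := by
    have h1 := mem_codiscreteWithin.1 hlog' w hwc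
    rw [Filter.disjoint_principal_right] at h1
    have h2 : ball (0 : ℂ) r ∈ nhdsWithin w {w}ᶜ :=
      nhdsWithin_le_nhds (isOpen_ball.mem_nhds hw)
    filter_upwards [h1, h2] with z hz1 hz2
    by_contra hcon
    exact hz1 ⟨ball_subset_closedBall hz2, hcon⟩
  have hcF : ContinuousAt (fun z => Real.log ‖F z‖) w :=
    ((hF w hwc).continuousAt.norm).log (by simpa using hFw)
  have hcR : ContinuousAt ((∑ u ∈ hfin.toFinset, (fun z : ℂ => (D u : ℝ) * Real.log ‖z - u‖)) +
        (fun z => Real.log ‖g z‖)) w := by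
    refine ContinuousAt.add ?_ (((hg w hwc).continuousAt.norm).log (by simpa using hgw))
    have : ContinuousAt (fun z : ℂ => ∑ u ∈ hfin.toFinset, ((D u : ℝ) * Real.log ‖z - u‖)) w := by
      refine tendsto_finsetSum _ fun u hu => ?_
      refine ContinuousAt.mul continuousAt_const (ContinuousAt.log (by fun_prop) ?_)
      simpa [sub_eq_zero] using hne u hu
    convert this using 1
    ext z; simp
  have hww := ((hcF.eventuallyEq_nhds_iff_eventuallyEq_nhdsNE hcR).1 hev).eq_of_nhds
  have hci : ∀ u, CircleIntegrable (fun z : ℂ => Real.log ‖z - u‖) 0 r := fun u =>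
    (analyticOnNhd_id.sub analyticOnNhd_const).meromorphicOn.circleIntegrable_log_norm
  have hintg : CircleIntegrable (fun z : ℂ => Real.log ‖g z‖) 0 r :=
    MeromorphicOn.circleIntegrable_log_norm fun z hz =>
      (hg z (sphere_subset_closedBall (by rwa [abs_of_pos hr] at hz))).meromorphicAt
  calc Real.log ‖F w‖ = (∑ u ∈ hfin.toFinset, (D u : ℝ) * Real.log ‖w - u‖) + Real.log ‖g w‖ := by
        simpa using hww
    _ ≤ (∑ u ∈ hfin.toFinset, (D u : ℝ) *
          circleAverage (poissonKernel 0 w * (Real.log ‖· - u‖)) 0 r) +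
        circleAverage (poissonKernel 0 w * (Real.log ‖g ·‖)) 0 r := by
        refine add_le_add (Finset.sum_le_sum fun u hu => ?_) (le_of_eq ?_)
        · exact mul_le_mul_of_nonneg_left (log_norm_sub_le_circleAverage (hmem u hu) hw (hne u hu))
            (by exact_mod_cast hD0 u)
        · have hh : InnerProductSpace.HarmonicOnNhd (fun z => Real.log ‖g z‖) (closedBall 0 r) :=
            fun z hz => (hg z hz).harmonicAt_log_norm (hg0 ⟨z, hz⟩)
          exact (hh.circleAverage_poissonKernel_smul hw).symm
    _ = circleAverage ((∑ u ∈ hfin.toFinset,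
          (D u : ℝ) • (poissonKernel 0 w * (Real.log ‖· - u‖))) +
          poissonKernel 0 w * (Real.log ‖g ·‖)) 0 r := by
        have hi : ∀ u ∈ hfin.toFinset, CircleIntegrable
            ((D u : ℝ) • (poissonKernel 0 w * (Real.log ‖· - u‖))) 0 r := fun u _ =>
          (circleIntegrable_poissonKernel_mul hw (hci u)).const_smul
        rw [circleAverage_add (CircleIntegrable.sum _ hi)
          (circleIntegrable_poissonKernel_mul hw hintg), circleAverage_sum hi]
        simp_rw [circleAverage_smul, smul_eq_mul]
    _ = circleAverage (poissonKernel 0 w * (Real.log ‖F ·‖)) 0 r := by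
        refine circleAverage_congr_codiscreteWithin ?_ hr.ne'
        have h2 := codiscreteWithin_mono (show sphere (0 : ℂ) |r| ⊆ closedBall 0 r by
          rw [abs_of_pos hr]; exact sphere_subset_closedBall) hlog'
        filter_upwards [h2] with z hz
        simp only [Pi.add_apply, Pi.mul_apply, Finset.sum_apply, Pi.smul_apply, smul_eq_mul] at hz ⊢
        rw [hz, mul_add, Finset.mul_sum]
        congr 1
        exact Finset.sum_congr rfl fun u _ => by ring

/-- Lebesgue measure on one period. -/
def arcMeasure : Measure ℝ := volume.restrict (Ico 0 (2 * Real.pi))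

instance : IsFiniteMeasure arcMeasure := by
  unfold arcMeasure; infer_instance

/-- `-log ‖z‖` with values in the extended nonnegative reals (truncated at `0`). -/
def negLog (z : ℂ) : ENNReal := if z = 0 then ⊤ else ENNReal.ofReal (-Real.log ‖z‖)

lemma measurable_negLog : Measurable negLog := by
  unfold negLog
  exact Measurable.ite (measurableSet_singleton 0) measurable_const (by fun_prop)

/-- The normalized Poisson density of the circle of radius `r` at the point `z`. -/
def poissonDensity (r : ℝ) (z : ℂ) (t : ℝ) : ENNReal :=
  ENNReal.ofReal ((2 * Real.pi)⁻¹ * poissonKernel 0 z (circleMap 0 r t))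

lemma measurable_poissonDensity_right (r : ℝ) (z : ℂ) : Measurable (poissonDensity r z) := by
  unfold poissonDensity poissonKernel
  have : Measurable fun t : ℝ => circleMap 0 r t := by fun_prop
  fun_prop

lemma poissonKernel_nonneg {r : ℝ} {z w : ℂ} (hz : ‖z‖ ≤ r) (hw : ‖w‖ = r) :
    0 ≤ poissonKernel 0 z w := by
  unfold poissonKernel
  simp only [sub_zero]
  have : ‖z‖ ^ 2 ≤ ‖w‖ ^ 2 := by rw [hw]; gcongr
  have := sub_nonneg.2 this
  positivity

lemma norm_circleMap_zero_of_pos {r : ℝ} (hr : 0 ≤ r) (t : ℝ) : ‖circleMap 0 r t‖ = r := by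
  rw [norm_circleMap_zero, abs_of_nonneg hr]

lemma lintegral_arcMeasure_circleMap {r : ℝ} {q : ℂ → ℝ} (hq : CircleIntegrable q 0 r)
    (h0 : ∀ t, 0 ≤ q (circleMap 0 r t)) :
    ∫⁻ t, ENNReal.ofReal ((2 * Real.pi)⁻¹ * q (circleMap 0 r t)) ∂arcMeasure =
      ENNReal.ofReal (Real.circleAverage q 0 r) := by
  have hpi := Real.two_pi_pos
  unfold arcMeasure
  rw [restrict_Ico_eq_restrict_Ioc]
  have hi : IntegrableOn (fun t => q (circleMap 0 r t)) (Ioc 0 (2 * Real.pi)) :=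
    (intervalIntegrable_iff_integrableOn_Ioc_of_le hpi.le).1 hq
  rw [← ofReal_integral_eq_lintegral_ofReal (hi.const_mul _)
    (Eventually.of_forall fun t => mul_nonneg (by positivity) (h0 t)), integral_const_mul,
    Real.circleAverage_def, intervalIntegral.integral_of_le hpi.le]
  rfl

open Metric in
lemma lintegral_poissonDensity {r : ℝ} {z : ℂ} (hz : ‖z‖ < r) :
    ∫⁻ t, poissonDensity r z t ∂arcMeasure = 1 := by
  have hr : 0 < r := (norm_nonneg z).trans_lt hz
  have hz' : z ∈ ball (0 : ℂ) r := mem_ball_zero_iff.2 hz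
  unfold poissonDensity
  rw [lintegral_arcMeasure_circleMap (q := poissonKernel 0 z)
    ((continuous_poissonKernel_circleMap hz').intervalIntegrable _ _)
    fun t => poissonKernel_nonneg hz.le (norm_circleMap_zero_of_pos hr.le t)]
  have h2 := InnerProductSpace.HarmonicOnNhd.circleAverage_poissonKernel_smul
    (f := fun _ => (1 : ℝ)) (c := 0)
    (fun x _ => InnerProductSpace.harmonicAt_const _) hz'
  have h3 : poissonKernel 0 z • (fun _ : ℂ => (1 : ℝ)) = poissonKernel 0 z := by
    ext; simp
  rw [h3] at h2
  simp [h2]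

open Metric in
lemma lintegral_poissonDensity_mul_negLog_le {F : ℂ → ℂ} {r : ℝ} {z : ℂ}
    (hF : DifferentiableOn ℂ F (ball 0 1)) (hF1 : ∀ w ∈ ball (0 : ℂ) 1, ‖F w‖ ≤ 1)
    (hz : ‖z‖ < r) (hr1 : r < 1) :
    ∫⁻ t, poissonDensity r z t * negLog (F (circleMap 0 r t)) ∂arcMeasure ≤ negLog (F z) := by
  have hr : 0 < r := (norm_nonneg z).trans_lt hz
  have hz' : z ∈ ball (0 : ℂ) r := mem_ball_zero_iff.2 hz
  by_cases hFz : F z = 0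
  · simp [negLog, hFz]
  have han : AnalyticOnNhd ℂ F (closedBall 0 r) :=
    (hF.analyticOnNhd isOpen_ball).mono (closedBall_subset_ball hr1)
  have hcod := han.preimage_zero_mem_codiscreteWithin hFz (ball_subset_closedBall hz')
    (Metric.isConnected_closedBall hr.le)
  have hsph : sphere (0 : ℂ) |r| ⊆ closedBall 0 r := by
    rw [abs_of_pos hr]; exact sphere_subset_closedBall
  have hae : ∀ᵐ t ∂arcMeasure, F (circleMap 0 r t) ≠ 0 := by
    unfold arcMeasure
    apply ae_restrict_le_codiscreteWithin measurableSet_Ico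
    exact codiscreteWithin_mono (subset_univ _)
      (circleMap_preimage_codiscrete hr.ne' (codiscreteWithin_mono hsph hcod))
  have hball : ∀ t, circleMap 0 r t ∈ ball (0 : ℂ) 1 := fun t => by
    rw [mem_ball_zero_iff, norm_circleMap_zero_of_pos hr.le]; exact hr1
  have hci : CircleIntegrable (fun w => Real.log ‖F w‖) 0 r :=
    MeromorphicOn.circleIntegrable_log_norm fun w hw => (han w (hsph hw)).meromorphicAt
  have hq := (circleIntegrable_poissonKernel_mul hz' hci).neg
  have hnn : ∀ t, 0 ≤ (-(poissonKernel 0 z * fun w => Real.log ‖F w‖)) (circleMap 0 r t) := by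
    intro t
    have h1 := poissonKernel_nonneg hz.le (norm_circleMap_zero_of_pos hr.le t)
    have h2 := Real.log_nonpos (norm_nonneg _) (hF1 _ (hball t))
    simp only [Pi.neg_apply, Pi.mul_apply]
    nlinarith
  calc _ = ∫⁻ t, ENNReal.ofReal ((2 * Real.pi)⁻¹ *
        (-(poissonKernel 0 z * fun w => Real.log ‖F w‖)) (circleMap 0 r t)) ∂arcMeasure := by
        refine lintegral_congr_ae ?_
        filter_upwards [hae] with t ht
        rw [negLog, if_neg ht, poissonDensity, ← ENNReal.ofReal_mul]
        · congr 1
          simp only [Pi.neg_apply, Pi.mul_apply]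
          ring
        · exact mul_nonneg (by positivity)
            (poissonKernel_nonneg hz.le (norm_circleMap_zero_of_pos hr.le t))
    _ = ENNReal.ofReal (Real.circleAverage (-(poissonKernel 0 z * fun w => Real.log ‖F w‖)) 0 r) :=
        lintegral_arcMeasure_circleMap hq hnn
    _ ≤ negLog (F z) := by
        rw [negLog, if_neg hFz]
        refine ENNReal.ofReal_le_ofReal ?_
        have h1 := log_norm_le_circleAverage_poissonKernel han hz' hFz
        have h2 : Real.circleAverage (-(poissonKernel 0 z * fun w => Real.log ‖F w‖)) 0 r =
            - Real.circleAverage (poissonKernel 0 z * fun w => Real.log ‖F w‖) 0 r := by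
          rw [← neg_one_smul ℝ, Real.circleAverage_smul, neg_one_smul]
        linarith

open Metric in
lemma le_poissonKernel {r : ℝ} {a ζ : ℂ} (ha : ‖a‖ < r) (hζ : ‖ζ‖ = r) :
    (r - ‖a‖) / (r + ‖a‖) ≤ poissonKernel 0 a ζ := by
  have := le_re_herglotzRieszKernel (c := 0) (R := r) (z := ζ) (w := a) (by simpa using hζ)
    (by simpa using ha)
  rw [poissonKernel_eq_re_herglotzRieszKernel]
  simpa [herglotzRieszKernel] using this

open Metric in
lemma le_lintegral_poissonDensity_comp {h : ℂ → ℂ} {ρ r : ℝ} (hρ0 : 0 < ρ) (hρ : ρ < 1)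
    (hh : DifferentiableOn ℂ h (ball 0 1)) (hhr : ∀ w ∈ closedBall (0 : ℂ) ρ, ‖h w‖ < r)
    (hr : (1 + ‖h 0‖) / 2 ≤ r) (hr1 : r < 1) (t : ℝ) :
    ENNReal.ofReal ((1 - ‖h 0‖) / 4) ≤
      ∫⁻ s, poissonDensity r (h (circleMap 0 ρ s)) t ∂arcMeasure := by
  have h0 := norm_nonneg (h 0)
  have hr0 : 0 < r := by linarith
  set ζ := circleMap 0 r t
  have hζ : ‖ζ‖ = r := norm_circleMap_zero_of_pos hr0.le t
  have hcirc : ∀ s, circleMap 0 ρ s ∈ closedBall (0 : ℂ) ρ := fun s => by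
    rw [mem_closedBall_zero_iff, norm_circleMap_zero_of_pos hρ0.le]
  have hne : ∀ w ∈ closedBall (0 : ℂ) ρ, ζ - h w ≠ 0 := by
    intro w hw h1
    have := hhr w hw
    rw [← sub_eq_zero.1 h1, hζ] at this
    exact lt_irrefl _ this
  set k : ℂ → ℂ := fun w => (ζ + h w) / (ζ - h w)
  have hk : DifferentiableOn ℂ k (closedBall 0 ρ) := by
    have := hh.mono (closedBall_subset_ball hρ)
    exact (this.const_add ζ).div (this.const_sub ζ) hne
  have hkre : ∀ w, poissonKernel 0 (h w) ζ = (k w).re := fun w => by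
    rw [poissonKernel_eq_re_herglotzRieszKernel]
    simp [herglotzRieszKernel, k]
  have hkc : Continuous fun s => k (circleMap 0 ρ s) :=
    hk.continuousOn.comp_continuous (continuous_circleMap 0 ρ) hcirc
  have hki : CircleIntegrable k 0 ρ := hkc.intervalIntegrable _ _
  have hqi : CircleIntegrable (fun w => poissonKernel 0 (h w) ζ) 0 ρ := by
    simp_rw [hkre]
    exact (Complex.continuous_re.comp hkc).intervalIntegrable _ _
  unfold poissonDensity
  rw [lintegral_arcMeasure_circleMap (q := fun w => poissonKernel 0 (h w) ζ) hqi
    fun s => poissonKernel_nonneg (hhr _ (hcirc s)).le hζ]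
  refine ENNReal.ofReal_le_ofReal ?_
  have hav : Real.circleAverage (fun w => poissonKernel 0 (h w) ζ) 0 ρ =
      poissonKernel 0 (h 0) ζ := by
    simp_rw [hkre]
    have h1 : DiffContOnCl ℂ k (ball 0 |ρ|) := by
      rw [abs_of_pos hρ0]
      exact hk.diffContOnCl_ball subset_rfl
    have h2 := Complex.reCLM.circleAverage_comp_comm (f := k) (c := 0) (R := ρ) hki
    rw [h1.circleAverage] at h2
    exact h2
  rw [hav]
  refine le_trans ?_ (le_poissonKernel (hhr 0 (mem_closedBall_self hρ0.le)) hζ)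
  rw [div_le_div_iff₀ (by norm_num) (by linarith)]
  nlinarith

lemma lintegral_pi_prod_eq {ι : Type*} [Fintype ι] [DecidableEq ι] (μ : ι → Measure ℝ)
    [∀ i, SigmaFinite (μ i)] {f : ι → ℝ → ENNReal} (hf : ∀ i, Measurable (f i)) :
    ∫⁻ x, ∏ i, f i (x i) ∂(Measure.pi μ) = ∏ i, ∫⁻ t, f i t ∂(μ i) := by
  have key : ∀ s : Finset ι, lmarginal μ s (fun x => ∏ i ∈ s, f i (x i)) =
      fun _ => ∏ i ∈ s, ∫⁻ t, f i t ∂(μ i) := by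
    intro s
    induction s using Finset.induction_on with
    | empty => ext x; simp
    | insert i s hi ih =>
      rw [lmarginal_insert' _ (by fun_prop) hi]
      have : (fun x : ι → ℝ => ∫⁻ t, ∏ j ∈ insert i s, f j (Function.update x i t j) ∂μ i) =
          fun x => (∫⁻ t, f i t ∂μ i) * ∏ j ∈ s, f j (x j) := by
        ext x
        rw [← lintegral_mul_const _ (hf i)]
        refine lintegral_congr fun t => ?_
        rw [Finset.prod_insert hi, Function.update_self]
        congr 1
        refine Finset.prod_congr rfl fun j hj => ?_
        rw [Function.update_of_ne (by rintro rfl; exact hi hj)]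
      rw [this]
      ext x
      rw [Finset.prod_insert hi]
      have h2 := congrFun ih x
      simp only [lmarginal] at h2 ⊢
      rw [lintegral_const_mul _ (by fun_prop), h2]
  have := key Finset.univ
  rw [lmarginal_univ] at this
  exact congrFun this fun _ => 0

/-- The product of `n` copies of `arcMeasure`. -/
def boxMeasure (n : ℕ) : Measure (Fin n → ℝ) := Measure.pi fun _ => arcMeasure

lemma boxMeasure_eq (n : ℕ) :
    boxMeasure n = volume.restrict (Set.pi univ fun _ : Fin n => Ico (0 : ℝ) (2 * Real.pi)) := by
  rw [volume_pi, Measure.restrict_pi_pi]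
  rfl

instance (n : ℕ) : IsFiniteMeasure (boxMeasure n) := by
  unfold boxMeasure; infer_instance

/-- The point of the torus of radius `r` with angles `θ`. -/
def torusPoint {n : ℕ} (r : ℝ) (θ : Fin n → ℝ) : Fin n → ℂ := fun i => circleMap 0 r (θ i)

lemma torusPoint_mem_polydisk {n : ℕ} {r : ℝ} (hr : 0 ≤ r) (hr1 : r < 1) (θ : Fin n → ℝ) :
    torusPoint r θ ∈ polydisk n := fun i => by
  rw [torusPoint, norm_circleMap_zero_of_pos hr]; exact hr1

lemma continuous_torusPoint {n : ℕ} (r : ℝ) : Continuous (torusPoint (n := n) r) := by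
  unfold torusPoint; fun_prop

lemma continuous_comp_torusPoint {n : ℕ} {f : (Fin n → ℂ) → ℂ} (hf : HoloOnPolydisk f)
    {r : ℝ} (hr : 0 ≤ r) (hr1 : r < 1) : Continuous fun θ => f (torusPoint r θ) :=
  hf.continuousOn.comp_continuous (continuous_torusPoint r) (torusPoint_mem_polydisk hr hr1)

lemma update_mem_polydisk {n : ℕ} {z : Fin n → ℂ} (hz : z ∈ polydisk n) (i : Fin n) {w : ℂ}
    (hw : ‖w‖ < 1) : Function.update z i w ∈ polydisk n := by
  intro j
  by_cases h : j = i
  · subst h; simpa using hw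
  · rw [Function.update_of_ne h]; exact hz j

open Metric in
theorem lintegral_prod_poissonDensity_mul_negLog_le {n : ℕ} {f : (Fin n → ℂ) → ℂ}
    (hf : InBallHinf f) {r : ℝ} (hr : 0 < r) (hr1 : r < 1) {z : Fin n → ℂ}
    (hz : ∀ i, ‖z i‖ < r) :
    ∫⁻ θ, (∏ i, poissonDensity r (z i) (θ i)) * negLog (f (torusPoint r θ)) ∂boxMeasure n ≤
      negLog (f z) := by
  obtain ⟨mix, hmix⟩ : ∃ mix : Finset (Fin n) → (Fin n → ℝ) → (Fin n → ℂ), mix = fun s θ i =>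
    if i ∈ s then circleMap 0 r (θ i) else z i := ⟨_, rfl⟩
  have hmixmem : ∀ s θ, mix s θ ∈ polydisk n := by
    intro s θ i
    by_cases h : i ∈ s
    · simp only [hmix, h, if_true, norm_circleMap_zero_of_pos hr.le, hr1]
    · simp only [hmix, h, if_false]; exact (hz i).trans hr1
  have hmixc : ∀ s, Continuous (mix s) := by
    intro s
    refine continuous_pi fun i => ?_
    by_cases h : i ∈ s
    · simp only [hmix, h, if_true]; fun_prop
    · simp only [hmix, h, if_false]; fun_prop
  have hfmeas : ∀ s, Measurable fun θ => negLog (f (mix s θ)) := fun s =>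
    measurable_negLog.comp (hf.1.continuousOn.comp_continuous (hmixc s) (hmixmem s)).measurable
  have hPmeas : ∀ i, Measurable fun t => poissonDensity r (z i) t := fun i =>
    measurable_poissonDensity_right r (z i)
  have hGmeas : ∀ s : Finset (Fin n), Measurable fun θ : Fin n → ℝ =>
      (∏ i ∈ s, poissonDensity r (z i) (θ i)) * negLog (f (mix s θ)) := fun s =>
    (Finset.measurable_prod s fun i _ => (hPmeas i).comp (measurable_pi_apply i)).mul (hfmeas s)
  have key : ∀ s : Finset (Fin n), lmarginal (fun _ => arcMeasure) s (fun θ : Fin n → ℝ =>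
      (∏ i ∈ s, poissonDensity r (z i) (θ i)) * negLog (f (mix s θ))) ≤
      fun _ => negLog (f z) := by
    intro s
    induction s using Finset.induction_on with
    | empty =>
      intro θ
      simp [hmix]
    | insert i s hi ih =>
      rw [lmarginal_insert' _ (hGmeas _) hi]
      refine le_trans (lmarginal_mono fun θ => ?_) ih
      have hF : DifferentiableOn ℂ (fun w => f (Function.update (mix s θ) i w)) (ball 0 1) := by
        refine hf.1.comp (fun w _ => ?_) fun w hw =>
          update_mem_polydisk (hmixmem s θ) i (by simpa using hw)
        exact (hasFDerivAt_update (mix s θ) w).differentiableAt.differentiableWithinAt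
      have h1 := lintegral_poissonDensity_mul_negLog_le hF (fun w hw => hf.2 _
        (update_mem_polydisk (hmixmem s θ) i (by simpa using hw))) (hz i) hr1
      have hzi : Function.update (mix s θ) i (z i) = mix s θ := by
        rw [Function.update_eq_self_iff]
        simp [hmix, hi]
      rw [hzi] at h1
      refine le_trans (le_of_eq ?_) (mul_le_mul_right h1 (∏ i ∈ s, poissonDensity r (z i) (θ i)))
      have hm : Measurable fun t => poissonDensity r (z i) t *
          negLog (f (Function.update (mix s θ) i (circleMap 0 r t))) := by
        refine (hPmeas i).mul (measurable_negLog.comp ?_)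
        refine (hf.1.continuousOn.comp_continuous (by fun_prop) fun t =>
          update_mem_polydisk (hmixmem s θ) i ?_).measurable
        rw [norm_circleMap_zero_of_pos hr.le]; exact hr1
      rw [← lintegral_const_mul _ hm]
      refine lintegral_congr fun t => ?_
      have hu : mix (insert i s) (Function.update θ i t) =
          Function.update (mix s θ) i (circleMap 0 r t) := by
        ext j
        by_cases h : j = i
        · subst h; simp [hmix]
        · simp [hmix, h]
      have hp : ∏ j ∈ s, poissonDensity r (z j) (Function.update θ i t j) =
          ∏ j ∈ s, poissonDensity r (z j) (θ j) :=
        Finset.prod_congr rfl fun j hj => by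
          rw [Function.update_of_ne (by rintro rfl; exact hi hj)]
      rw [hu, Finset.prod_insert hi, hp, Function.update_self]
      ring
  have h := key Finset.univ
  rw [lmarginal_univ] at h
  have h' := h fun _ => 0
  have he : ∀ θ, mix Finset.univ θ = torusPoint r θ := fun θ => by
    ext i; simp [hmix, torusPoint]
  simp only [he] at h'
  exact h'

open Metric in
/-- A derivative formula on the real radius, obtained from the Poisson integral formula. -/
lemma deriv_mul_eq_circleAverage {H : ℂ → ℂ} (hc : Continuous H)
    (hd : DifferentiableOn ℂ H (ball 0 1)) {r : ℝ} (hr : 0 ≤ r) (hr1 : r < 1) :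
    Real.circleAverage (poissonKernel 0 r • fun w => H w * ((1 - r ^ 2) * (1 - w ^ 2) /
      ((w - r) * (1 - r * w)))) 0 1 = (1 - (r : ℂ) ^ 2) * deriv H r := by
  have hrb : (r : ℂ) ∈ ball (0 : ℂ) 1 := by
    rw [mem_ball_zero_iff, Complex.norm_real, Real.norm_of_nonneg hr]; exact hr1
  have hne1 : ∀ w ∈ closedBall (0 : ℂ) 1, 1 - r * w ≠ 0 := by
    intro w hw h0
    rw [mem_closedBall_zero_iff] at hw
    have := congrArg norm (sub_eq_zero.1 h0)
    rw [norm_one, norm_mul, Complex.norm_real, Real.norm_of_nonneg hr] at this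
    nlinarith [norm_nonneg w]
  have hne2 : ∀ w ∈ sphere (0 : ℂ) 1, w - r ≠ 0 := by
    intro w hw h0
    rw [sub_eq_zero.1 h0, mem_sphere_zero_iff_norm, Complex.norm_real,
      Real.norm_of_nonneg hr] at hw
    exact hr1.ne hw
  -- the Blaschke factor
  set b : ℂ → ℂ := fun w => (w - r) / (1 - r * w)
  have hb : DifferentiableOn ℂ b (closedBall 0 1) := by
    refine DifferentiableOn.div (by fun_prop) (by fun_prop) hne1
  have hb0 : b r = 0 := by simp [b]
  have hbc : DiffContOnCl ℂ b (ball 0 1) := hb.diffContOnCl_ball subset_rfl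
  have hHc : DiffContOnCl ℂ H (ball 0 1) := ⟨hd, hc.continuousOn⟩
  have hsl : DiffContOnCl ℂ (dslope H r) (ball 0 1) := by
    refine ⟨(Complex.differentiableOn_dslope (isOpen_ball.mem_nhds hrb)).2 hd, ?_⟩
    rw [closure_ball _ one_ne_zero]
    refine (continuousOn_dslope (Filter.mem_of_superset (isOpen_ball.mem_nhds hrb)
      ball_subset_closedBall)).2 ⟨hc.continuousOn, hd.differentiableAt (isOpen_ball.mem_nhds hrb)⟩
  have hlin : DiffContOnCl ℂ (fun w : ℂ => 1 - r * w) (ball 0 1) :=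
    Differentiable.diffContOnCl (by fun_prop)
  have hf : DiffContOnCl ℂ (fun w : ℂ => (1 - r * w) • dslope H r w - H w • b w) (ball 0 1) :=
    (hlin.smul hsl).sub (hHc.smul hbc)
  have h1 := hf.circleAverage_poissonKernel_smul hrb
  have h2 := hbc.circleAverage_poissonKernel_smul hrb
  simp only [hb0, dslope_same, smul_eq_mul, mul_zero, sub_zero] at h1 h2
  have hPc : Continuous fun t : ℝ => poissonKernel 0 r (circleMap 0 1 t) :=
    continuous_poissonKernel_circleMap hrb
  have hbcirc : Continuous fun t : ℝ => b (circleMap 0 1 t) :=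
    hb.continuousOn.comp_continuous (continuous_circleMap 0 1) fun t => by
      rw [mem_closedBall_zero_iff, norm_circleMap_zero, abs_one]
  have hPb : CircleIntegrable (poissonKernel 0 r • b) 0 1 :=
    (hPc.smul hbcirc).intervalIntegrable _ _
  have hconj : Real.circleAverage (poissonKernel 0 r • fun w => starRingEnd ℂ (b w)) 0 1 = 0 := by
    have := (Complex.conjCLE : ℂ →L[ℝ] ℂ).circleAverage_comp_comm hPb
    rw [h2, map_zero] at this
    refine Eq.trans ?_ this
    refine congrArg (fun q => Real.circleAverage q 0 1) ?_
    ext w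
    simp
  have hconjI : CircleIntegrable (poissonKernel 0 r • fun w => starRingEnd ℂ (b w)) 0 1 :=
    (hPc.smul (Complex.continuous_conj.comp hbcirc)).intervalIntegrable _ _
  have hslcirc : Continuous fun t : ℝ => dslope H r (circleMap 0 1 t) :=
    hsl.continuousOn.comp_continuous (continuous_circleMap 0 1) fun t => by
      rw [closure_ball _ one_ne_zero, mem_closedBall_zero_iff, norm_circleMap_zero, abs_one]
  have hfI : CircleIntegrable (poissonKernel 0 r • fun w : ℂ => (1 - r * w) * dslope H r w -
      H w * b w) 0 1 := by
    refine (Continuous.intervalIntegrable ?_ _ _)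
    refine hPc.smul (Continuous.sub (Continuous.mul (by fun_prop) hslcirc) (Continuous.mul ?_ hbcirc))
    exact hc.comp (continuous_circleMap 0 1)
  have h3 := Real.circleAverage_add hfI (hconjI.const_smul (a := H r))
  rw [h1, Real.circleAverage_smul, hconj, smul_zero, add_zero] at h3
  rw [pow_two (r : ℂ), ← h3]
  refine Real.circleAverage_congr_sphere fun w hw => ?_
  rw [abs_one] at hw
  have hw1 := hne1 w (sphere_subset_closedBall hw)
  have hw2 := hne2 w hw
  have hww : w * starRingEnd ℂ w = 1 := by
    rw [Complex.mul_conj, Complex.normSq_eq_norm_sq, mem_sphere_zero_iff_norm.1 hw]; simp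
  have hcb : starRingEnd ℂ (b w) = (1 - r * w) / (w - r) := by
    have hw3 : 1 - r * starRingEnd ℂ w ≠ 0 := by
      intro h0
      apply hw1
      have := congrArg (starRingEnd ℂ) h0
      simpa using this
    simp only [b, map_div₀, map_sub, map_mul, Complex.conj_ofReal, map_one]
    rw [div_eq_div_iff hw3 hw2]
    linear_combination (1 - (r : ℂ) ^ 2) * hww
  have hds : dslope H r w = (H w - H r) / (w - r) := by
    rw [dslope_of_ne _ (by simpa [sub_eq_zero] using hw2), slope_def_field]
  simp only [Pi.smul_apply', Pi.add_apply, Pi.smul_apply, hds, hcb, b, smul_eq_mul,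
    Complex.real_smul]
  field_simp
  ring

open Metric in
lemma norm_deriv_le_of_tangent {H : ℂ → ℂ} (hc : Continuous H)
    (hd : DifferentiableOn ℂ H (ball 0 1)) {ε δ B : ℝ} (hε : 0 ≤ ε) (hδ : 0 < δ)
    (hB : ∀ w ∈ sphere (0 : ℂ) 1, ‖H w‖ ≤ B)
    (htan : ∀ w ∈ sphere (0 : ℂ) 1, ‖w - 1‖ < δ → ‖H w‖ ≤ ε * ‖w - 1‖)
    {r : ℝ} (hr : 0 ≤ r) (hr1 : r < 1) :
    ‖deriv H r‖ ≤ 8 * ε + (1 - r ^ 2) * (64 * B / δ ^ 4) := by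
  have hrb : (r : ℂ) ∈ ball (0 : ℂ) 1 := by
    rw [mem_ball_zero_iff, Complex.norm_real, Real.norm_of_nonneg hr]; exact hr1
  have hr2 : 0 < 1 - r ^ 2 := by nlinarith
  have hB0 : 0 ≤ B := (norm_nonneg _).trans (hB 1 (by simp))
  set P : ℂ → ℝ := poissonKernel 0 r
  set q : ℂ → ℂ := fun w => H w * ((1 - r ^ 2) * (1 - w ^ 2) / ((w - r) * (1 - r * w)))
  have hPc : Continuous fun t : ℝ => P (circleMap 0 1 t) :=
    continuous_poissonKernel_circleMap hrb
  have hpt : ∀ w ∈ sphere (0 : ℂ) 1, ‖(P • q) w‖ ≤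
      (1 - r ^ 2) * (8 * ε * P w + (1 - r ^ 2) * (64 * B / δ ^ 4)) := by
    intro w hw
    have hw1 : ‖w‖ = 1 := mem_sphere_zero_iff_norm.1 hw
    have hwr : 1 - r ≤ ‖w - r‖ := by
      have := norm_sub_norm_le w r
      rwa [hw1, Complex.norm_real, Real.norm_of_nonneg hr] at this
    have hwr0 : 0 < ‖w - r‖ := by linarith
    have hw2 : ‖w - 1‖ ≤ 2 * ‖w - r‖ := by
      have h1 : ‖w - 1‖ ≤ ‖w - r‖ + ‖(r : ℂ) - 1‖ := norm_sub_le_norm_sub_add_norm_sub _ _ _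
      have h2 : ‖(r : ℂ) - 1‖ = 1 - r := by
        rw [norm_sub_rev, show (1 : ℂ) - r = ((1 - r : ℝ) : ℂ) by push_cast; rfl,
          Complex.norm_real, Real.norm_of_nonneg (by linarith)]
      linarith
    have hn1 : ‖1 - r * w‖ = ‖w - r‖ := by
      have hww : w * starRingEnd ℂ w = 1 := by
        rw [Complex.mul_conj, Complex.normSq_eq_norm_sq, hw1]; simp
      have : 1 - r * w = w * starRingEnd ℂ (w - r) := by
        simp only [map_sub, Complex.conj_ofReal]; linear_combination -hww
      rw [this, norm_mul, hw1, RCLike.norm_conj, one_mul]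
    have hn2 : ‖1 - w ^ 2‖ ≤ 2 * ‖w - 1‖ := by
      have : 1 - w ^ 2 = -(w + 1) * (w - 1) := by ring
      rw [this, norm_mul, norm_neg]
      have : ‖w + 1‖ ≤ 2 := by
        have := norm_add_le w 1
        rw [hw1, norm_one] at this; linarith
      gcongr
    have hn3 : ‖(1 : ℂ) - r ^ 2‖ = 1 - r ^ 2 := by
      rw [show (1 : ℂ) - r ^ 2 = ((1 - r ^ 2 : ℝ) : ℂ) by push_cast; rfl,
          Complex.norm_real, Real.norm_of_nonneg hr2.le]
    have hPw : P w = (1 - r ^ 2) / ‖w - r‖ ^ 2 := by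
      simp [P, poissonKernel, hw1]
    have hP0 : 0 ≤ P w := by rw [hPw]; positivity
    have hnorm : ‖(P • q) w‖ ≤ P w * (‖H w‖ * ((1 - r ^ 2) * (2 * ‖w - 1‖) / ‖w - r‖ ^ 2)) := by
      simp only [Pi.smul_apply', q, norm_smul, norm_mul, norm_div, hn1, hn3,
        Real.norm_of_nonneg hP0]
      rw [← pow_two]
      gcongr
    refine hnorm.trans ?_
    have hx : ‖w - 1‖ / ‖w - r‖ ≤ 2 := by rwa [div_le_iff₀ hwr0]
    by_cases hcase : ‖w - 1‖ < δ
    · have h1 := htan w hw hcase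
      calc _ ≤ P w * ((ε * ‖w - 1‖) * ((1 - r ^ 2) * (2 * ‖w - 1‖) / ‖w - r‖ ^ 2)) := by gcongr
        _ = (1 - r ^ 2) * (2 * (‖w - 1‖ / ‖w - r‖) ^ 2 * ε * P w) := by ring
        _ ≤ (1 - r ^ 2) * (2 * 2 ^ 2 * ε * P w) := by gcongr
        _ = (1 - r ^ 2) * (8 * ε * P w) := by ring
        _ ≤ _ := by
          gcongr
          have : 0 ≤ (1 - r ^ 2) * (64 * B / δ ^ 4) := by positivity
          linarith
    · push Not at hcase
      have hwd : δ / 2 ≤ ‖w - r‖ := by linarith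
      have hw3 : ‖w - 1‖ ≤ 2 := by
        have := norm_sub_le w 1
        rw [hw1, norm_one] at this; linarith
      calc _ ≤ (1 - r ^ 2) / (δ / 2) ^ 2 * (B * ((1 - r ^ 2) * (2 * 2) / (δ / 2) ^ 2)) := by
            rw [hPw]
            gcongr
            exact hB w hw
        _ = (1 - r ^ 2) * ((1 - r ^ 2) * (64 * B / δ ^ 4)) := by
            field_simp; ring
        _ ≤ _ := by
          gcongr
          have : 0 ≤ 8 * ε * P w := by positivity
          linarith
  have hPi : CircleIntegrable P 0 1 := hPc.intervalIntegrable _ _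
  have hPav : Real.circleAverage P 0 1 = 1 := by
    have h2 := InnerProductSpace.HarmonicOnNhd.circleAverage_poissonKernel_smul
      (f := fun _ => (1 : ℝ)) (c := 0)
      (fun x _ => InnerProductSpace.harmonicAt_const _) hrb
    have h3 : poissonKernel 0 (r : ℂ) • (fun _ : ℂ => (1 : ℝ)) = P := by
      ext; simp [P]
    rw [h3] at h2
    exact h2
  have hkey := deriv_mul_eq_circleAverage hc hd hr hr1
  have hbound : ‖Real.circleAverage (P • q) 0 1‖ ≤
      Real.circleAverage (fun w => (1 - r ^ 2) * (8 * ε * P w + (1 - r ^ 2) * (64 * B / δ ^ 4)))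
        0 1 := by
    rw [Real.circleAverage_def, Real.circleAverage_def, norm_smul, smul_eq_mul,
      Real.norm_of_nonneg (by positivity)]
    gcongr
    refine intervalIntegral.norm_integral_le_of_norm_le Real.two_pi_pos.le
      (Eventually.of_forall fun t _ => hpt _ (circleMap_mem_sphere 0 zero_le_one t)) ?_
    exact (((hPc.const_mul _).add continuous_const).const_mul _).intervalIntegrable _ _
  have hav : Real.circleAverage (fun w => (1 - r ^ 2) *
      (8 * ε * P w + (1 - r ^ 2) * (64 * B / δ ^ 4))) 0 1 =
      (1 - r ^ 2) * (8 * ε + (1 - r ^ 2) * (64 * B / δ ^ 4)) := by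
    have h1 : (fun w => (1 - r ^ 2) * (8 * ε * P w + (1 - r ^ 2) * (64 * B / δ ^ 4))) =
        ((1 - r ^ 2) * (8 * ε)) • P + fun _ => (1 - r ^ 2) * ((1 - r ^ 2) * (64 * B / δ ^ 4)) := by
      ext w; simp; ring
    rw [h1, Real.circleAverage_add hPi.const_smul (circleIntegrable_const _ _ _),
      Real.circleAverage_smul, hPav, Real.circleAverage_const]
    simp; ring
  rw [hkey, hav, norm_mul, show (1 : ℂ) - r ^ 2 = ((1 - r ^ 2 : ℝ) : ℂ) by push_cast; rfl,
    Complex.norm_real, Real.norm_of_nonneg hr2.le] at hbound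
  exact le_of_mul_le_mul_left hbound hr2

open Metric in
lemma exists_forall_norm_le_of_hasDerivAt_circle {H : ℂ → ℂ} (h1 : H 1 = 0)
    (hH : HasDerivAt (fun s : ℝ => H (circleMap 0 1 s)) 0 0) {ε : ℝ} (hε : 0 < ε) :
    ∃ δ > 0, ∀ w ∈ sphere (0 : ℂ) 1, ‖w - 1‖ < δ → ‖H w‖ ≤ ε * ‖w - 1‖ := by
  have hpi := Real.pi_pos
  have ho := hH.isLittleO
  have := ho.def (show 0 < ε / (Real.pi / 2) by positivity)
  obtain ⟨η, hη, hη'⟩ := Metric.eventually_nhds_iff.1 this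
  refine ⟨η / (Real.pi / 2), by positivity, fun w hw hwδ => ?_⟩
  have hw1 : ‖w‖ = 1 := mem_sphere_zero_iff_norm.1 hw
  have hw0 : w ≠ 0 := by rintro rfl; simp at hw1
  have harg : |w.arg| ≤ Real.pi / 2 * ‖w - 1‖ := by
    rw [← Complex.angle_one_right hw0]
    exact Complex.angle_le_mul_norm_sub hw1 (by simp)
  have hcw : circleMap 0 1 w.arg = w := by
    have := Complex.norm_mul_exp_arg_mul_I w
    rw [hw1] at this
    simpa [circleMap] using this
  have hlt : dist w.arg 0 < η := by
    rw [Real.dist_eq, sub_zero]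
    rw [lt_div_iff₀ (by positivity)] at hwδ
    linarith
  have h2 := hη' hlt
  have hc0 : circleMap 0 1 0 = 1 := by simp [circleMap]
  simp only [hcw, hc0, h1, sub_zero, smul_zero] at h2
  rw [Real.norm_eq_abs] at h2
  calc ‖H w‖ ≤ ε / (Real.pi / 2) * |w.arg| := h2
    _ ≤ ε / (Real.pi / 2) * (Real.pi / 2 * ‖w - 1‖) := by gcongr
    _ = ε * ‖w - 1‖ := by field_simp

open Metric Topology in
/-- **Fatou's theorem**: bounded holomorphic functions on the disc have radial limits almost
everywhere. -/
theorem ae_exists_tendsto_radial {F : ℂ → ℂ} (hF : DifferentiableOn ℂ F (ball 0 1)) {M : ℝ}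
    (hM : ∀ w ∈ ball (0 : ℂ) 1, ‖F w‖ ≤ M) :
    ∀ᵐ t : ℝ, ∃ l, Tendsto (fun r : ℝ => F (circleMap 0 r t)) (𝓝[<] 1) (𝓝 l) := by
  have hM0 : 0 ≤ M := (norm_nonneg _).trans (hM 0 (by simp))
  obtain ⟨G₀, hG₀⟩ := hF.isExactOn_ball
  have hlip := (convex_ball (0 : ℂ) 1).lipschitzOnWith_of_nnnorm_hasDerivWithin_le (C := M.toNNReal)
    (fun x hx => (hG₀ x hx).hasDerivWithinAt) (fun x hx => by
      rw [← NNReal.coe_le_coe, coe_nnnorm, Real.coe_toNNReal _ hM0]; exact hM x hx)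
  obtain ⟨G, hGl, hGe⟩ := hlip.extend_finite_dimension
  have hG : ∀ w ∈ ball (0 : ℂ) 1, HasDerivAt G (F w) w := fun w hw =>
    (hG₀ w hw).congr_of_eventuallyEq
      (Filter.mem_of_superset (isOpen_ball.mem_nhds hw) fun x hx => (hGe hx).symm)
  have hφ : LipschitzWith _ (fun t => G (circleMap 0 1 t)) :=
    hGl.comp (lipschitzWith_circleMap 0 1)
  filter_upwards [hφ.ae_differentiableAt_real] with t ht
  set ζ := circleMap 0 1 t
  have hζ : ‖ζ‖ = 1 := norm_circleMap_zero_of_pos zero_le_one t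
  have hζ0 : ζ ≠ 0 := by intro h; simp [h] at hζ
  set D := deriv (fun t => G (circleMap 0 1 t)) t / Complex.I
  set H : ℂ → ℂ := fun w => G (ζ * w) - G ζ - D * (w - 1)
  have hHc : Continuous H := by
    have := hGl.continuous
    fun_prop
  have hHd : ∀ w ∈ ball (0 : ℂ) 1, HasDerivAt H (ζ * F (ζ * w) - D) w := by
    intro w hw
    have hmem : ζ * w ∈ ball (0 : ℂ) 1 := by
      rw [mem_ball_zero_iff, norm_mul, hζ, one_mul]; simpa using hw
    have h1 : HasDerivAt (fun w => ζ * w) ζ w := by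
      simpa using (hasDerivAt_id w).const_mul ζ
    have h2 := (hG _ hmem).comp w h1
    have h3 := (h2.sub_const (G ζ)).sub (((hasDerivAt_id w).sub_const 1).const_mul D)
    rw [mul_one, mul_comm _ ζ] at h3
    exact h3
  have hHdiff : DifferentiableOn ℂ H (ball 0 1) := fun w hw =>
    (hHd w hw).differentiableAt.differentiableWithinAt
  have hH1 : H 1 = 0 := by simp [H]
  have hHt : HasDerivAt (fun s : ℝ => H (circleMap 0 1 s)) 0 0 := by
    have h1 : HasDerivAt (fun s : ℝ => G (circleMap 0 1 (t + s))) (D * Complex.I) 0 := by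
      have : D * Complex.I = deriv (fun t => G (circleMap 0 1 t)) t :=
        div_mul_cancel₀ _ Complex.I_ne_zero
      rw [this]
      have := ht.hasDerivAt
      rw [show t = t + 0 by simp] at this
      have h := HasDerivAt.comp_const_add t 0 this
      simpa using h
    have h2 : HasDerivAt (fun s : ℝ => circleMap 0 1 s) Complex.I 0 := by
      have := hasDerivAt_circleMap 0 1 0
      rwa [circleMap_zero, Complex.ofReal_zero, zero_mul, Complex.exp_zero, Complex.ofReal_one,
        one_mul, one_mul] at this
    have h3 := (h1.sub_const (G ζ)).sub ((h2.sub_const 1).const_mul D)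
    rw [sub_self] at h3
    refine h3.congr_of_eventuallyEq (Eventually.of_forall fun s => ?_)
    have : circleMap 0 1 (t + s) = ζ * circleMap 0 1 s := by
      simp only [ζ, circleMap_zero]
      push_cast
      rw [add_mul, Complex.exp_add]
      ring
    simp [H, this]
  obtain ⟨B, hB⟩ := (isCompact_sphere (0 : ℂ) 1).exists_bound_of_continuousOn hHc.continuousOn
  have hlim : Tendsto (fun r : ℝ => deriv H r) (𝓝[<] 1) (𝓝 0) := by
    rw [Metric.tendsto_nhds]
    intro ε hε
    obtain ⟨δ, hδ, hδ'⟩ := exists_forall_norm_le_of_hasDerivAt_circle hH1 hHt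
      (show 0 < ε / 16 by positivity)
    have hcont : Tendsto (fun r : ℝ => 8 * (ε / 16) + (1 - r ^ 2) * (64 * B / δ ^ 4)) (𝓝[<] 1)
        (𝓝 (8 * (ε / 16) + (1 - 1 ^ 2) * (64 * B / δ ^ 4))) := by
      refine Tendsto.mono_left ?_ nhdsWithin_le_nhds
      exact (Continuous.tendsto (by fun_prop) 1)
    have hev := hcont.eventually_lt_const (u := ε) (by linarith)
    filter_upwards [hev, self_mem_nhdsWithin,
      nhdsWithin_le_nhds (Ioi_mem_nhds (show (0 : ℝ) < 1 by norm_num))] with r hr1 hr2 hr3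
    rw [dist_zero_right]
    exact (norm_deriv_le_of_tangent hHc hHdiff (by positivity) hδ hB hδ' hr3.le hr2).trans_lt hr1
  refine ⟨(0 + D) / ζ, ?_⟩
  refine ((hlim.add_const D).div_const ζ).congr' ?_
  filter_upwards [self_mem_nhdsWithin,
      nhdsWithin_le_nhds (Ioi_mem_nhds (show (0 : ℝ) < 1 by norm_num))] with r hr1 hr2
  have hrb : (r : ℂ) ∈ ball (0 : ℂ) 1 := by
    rw [mem_ball_zero_iff, Complex.norm_real, Real.norm_of_nonneg hr2.le]; exact hr1
  rw [(hHd _ hrb).deriv]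
  have : circleMap 0 r t = ζ * r := by simp [ζ, circleMap_zero, mul_comm]
  rw [this]
  field_simp
  ring

open Topology in
/-- Rational points of `[0, 1)` detect the limit at `1` of a continuous function. -/
lemma tendsto_nhdsLT_one_of_rat {u : ℝ → ℂ} (hu : ContinuousOn u (Ico 0 1)) {c : ℂ}
    (h : Tendsto (fun q : {q : ℚ // (0 : ℝ) ≤ q ∧ (q : ℝ) < 1} => u (q.1 : ℝ))
      (comap (fun q : {q : ℚ // (0 : ℝ) ≤ q ∧ (q : ℝ) < 1} => ((q.1 : ℚ) : ℝ)) (𝓝[<] 1)) (𝓝 c)) :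
    Tendsto u (𝓝[<] 1) (𝓝 c) := by
  rw [Metric.tendsto_nhds] at h ⊢
  intro ε hε
  obtain ⟨s, hs, hsub⟩ := mem_comap.1 (h (ε / 2) (half_pos hε))
  obtain ⟨a, ha, hau⟩ := (mem_nhdsLT_iff_exists_Ioo_subset (a := (1 : ℝ))).1 hs
  have hev : Ioo (max a 0) 1 ∈ 𝓝[<] (1 : ℝ) := Ioo_mem_nhdsLT (max_lt ha one_pos)
  filter_upwards [hev] with x hx
  by_contra hcon
  have hopen : IsOpen (Ioo (max a 0) 1 ∩ u ⁻¹' (Metric.closedBall c (ε / 2))ᶜ) :=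
    (hu.mono fun y hy => ⟨(le_max_right _ _).trans hy.1.le, hy.2⟩).isOpen_inter_preimage isOpen_Ioo
      Metric.isClosed_closedBall.isOpen_compl
  obtain ⟨q, hq⟩ := Rat.denseRange_cast.exists_mem_open hopen
    ⟨x, hx, by simp only [mem_preimage, mem_compl_iff, Metric.mem_closedBall]; linarith⟩
  have hq0 : (0 : ℝ) ≤ q := (le_max_right _ _).trans hq.1.1.le
  have h1 := @hsub ⟨q, hq0, hq.1.2⟩ (hau ⟨(le_max_left _ _).trans_lt hq.1.1, hq.1.2⟩)
  exact hq.2 (Metric.mem_closedBall.2 (le_of_lt h1))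

open Topology in
/-- Fatou's theorem on the polydisk: bounded holomorphic functions have radial limits almost
everywhere. -/
theorem ae_exists_tendsto_torusPoint {n : ℕ} {f : (Fin n → ℂ) → ℂ} (hf : HoloOnPolydisk f)
    {M : ℝ} (hM : ∀ z ∈ polydisk n, ‖f z‖ ≤ M) :
    ∀ᵐ θ : Fin n → ℝ, ∃ l, Tendsto (fun r : ℝ => f (torusPoint r θ)) (𝓝[<] 1) (𝓝 l) := by
  set lf := comap (fun q : {q : ℚ // (0 : ℝ) ≤ q ∧ (q : ℝ) < 1} => ((q.1 : ℚ) : ℝ)) (𝓝[<] 1)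
  set s : Set (Fin n → ℝ) := {θ | ∃ c, Tendsto
    (fun q : {q : ℚ // (0 : ℝ) ≤ q ∧ (q : ℝ) < 1} => f (torusPoint (q.1 : ℝ) θ)) lf (𝓝 c)}
  have hs : MeasurableSet s := measurableSet_exists_tendsto fun q =>
    (continuous_comp_torusPoint hf q.2.1 q.2.2).measurable
  have hradial : ∀ θ, ContinuousOn (fun r : ℝ => f (torusPoint r θ)) (Ico 0 1) := by
    intro θ
    refine hf.continuousOn.comp (Continuous.continuousOn ?_) fun r hr =>
      torusPoint_mem_polydisk hr.1 hr.2 θ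
    unfold torusPoint circleMap
    fun_prop
  let L : ℝ →ₗ[ℝ] (Fin n → ℝ) := LinearMap.pi fun _ => LinearMap.id
  have hae : ∀ᵐ θ : Fin n → ℝ, θ ∈ s := by
    refine ae_mem_of_ae_add_linearMap_mem L volume volume hs fun θ => ?_
    have hF : DifferentiableOn ℂ (fun w : ℂ => f fun i => w * Complex.exp (θ i * Complex.I))
        (Metric.ball 0 1) := by
      refine hf.comp (by fun_prop) fun w hw i => ?_
      rw [norm_mul, Complex.norm_exp_ofReal_mul_I, mul_one]
      simpa using hw
    filter_upwards [ae_exists_tendsto_radial hF fun w hw => hM _ fun i => by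
      rw [norm_mul, Complex.norm_exp_ofReal_mul_I, mul_one]
      simpa using hw] with t ht
    obtain ⟨l, hl⟩ := ht
    refine ⟨l, (hl.comp tendsto_comap).congr fun q => ?_⟩
    simp only [Function.comp]
    congr 1
    ext i
    simp only [torusPoint, circleMap, L, LinearMap.pi_apply, LinearMap.id_apply, Pi.add_apply]
    push_cast
    rw [add_mul ((θ i : ℝ) : ℂ), Complex.exp_add]
    ring
  filter_upwards [hae] with θ hθ
  obtain ⟨c, hc⟩ := hθ
  exact ⟨c, tendsto_nhdsLT_one_of_rat (hradial θ) hc⟩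

lemma isOpen_polydisk (n : ℕ) : IsOpen (polydisk n) := by
  have : polydisk n = ⋂ i, {z : Fin n → ℂ | ‖z i‖ < 1} := by ext; simp [polydisk]
  rw [this]
  exact isOpen_iInter_of_finite fun i => isOpen_lt (by fun_prop) continuous_const

lemma convex_polydisk (n : ℕ) : Convex ℝ (polydisk n) := by
  have : polydisk n = Set.pi univ fun _ => Metric.ball (0 : ℂ) 1 := by ext; simp [polydisk]
  rw [this]
  exact convex_pi fun i _ => convex_ball 0 1

open ComplexConjugate in
lemma one_add_conj_mul_ne_zero {b w : ℂ} (hb : ‖b‖ < 1) (hw : ‖w‖ < 1) : 1 + conj b * w ≠ 0 := by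
  intro h
  have h1 : ‖conj b * w‖ = 1 := by
    rw [show conj b * w = -1 by linear_combination h]; simp
  rw [norm_mul, Complex.norm_conj] at h1
  nlinarith [norm_nonneg b, norm_nonneg w]

open ComplexConjugate in
/-- Disc automorphisms map the disc to itself. -/
lemma norm_mobius_lt_one {b w : ℂ} (hb : ‖b‖ < 1) (hw : ‖w‖ < 1) :
    ‖(b + w) / (1 + conj b * w)‖ < 1 := by
  rw [norm_div, div_lt_one (norm_pos_iff.2 (one_add_conj_mul_ne_zero hb hw))]
  refine lt_of_pow_lt_pow_left₀ 2 (norm_nonneg _) ?_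
  have hb2 : ‖b‖ ^ 2 < 1 := by nlinarith [norm_nonneg b]
  have hw2 : ‖w‖ ^ 2 < 1 := by nlinarith [norm_nonneg w]
  have key : ‖1 + conj b * w‖ ^ 2 - ‖b + w‖ ^ 2 = (1 - ‖b‖ ^ 2) * (1 - ‖w‖ ^ 2) := by
    simp only [← Complex.normSq_eq_norm_sq, Complex.normSq_apply, Complex.add_re, Complex.add_im,
      Complex.mul_re, Complex.mul_im, Complex.conj_re, Complex.conj_im, Complex.one_re,
      Complex.one_im]
    ring
  nlinarith [mul_pos (sub_pos.2 hb2) (sub_pos.2 hw2)]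

open ComplexConjugate in
lemma hasDerivAt_mobius_zero (b v : ℂ) :
    HasDerivAt (fun w : ℂ => (b + w * v) / (1 + conj b * (w * v))) (v * (1 - ‖b‖ ^ 2 : ℝ)) 0 := by
  have h1 : HasDerivAt (fun w : ℂ => b + w * v) v 0 := by
    simpa using ((hasDerivAt_id (0 : ℂ)).mul_const v).const_add b
  have h2 : HasDerivAt (fun w : ℂ => 1 + conj b * (w * v)) (conj b * v) 0 := by
    simpa using (((hasDerivAt_id (0 : ℂ)).mul_const v).const_mul (conj b)).const_add 1
  convert! h1.div h2 (by simp) using 1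
  simp only [zero_mul, mul_zero, add_zero, mul_one, one_pow, div_one]
  push_cast
  rw [← Complex.conj_mul']
  ring

open Metric ComplexConjugate in
/-- The Schwarz-Pick estimate at the origin. -/
lemma norm_deriv_zero_le_one_sub_sq {F : ℂ → ℂ} (hF : DifferentiableOn ℂ F (ball 0 1))
    (hm : ∀ w ∈ ball (0 : ℂ) 1, ‖F w‖ < 1) : ‖deriv F 0‖ ≤ 1 - ‖F 0‖ ^ 2 := by
  have h0 : (0 : ℂ) ∈ ball (0 : ℂ) 1 := mem_ball_self one_pos
  set b := F 0 with hb
  have hb1 : ‖-b‖ < 1 := by rw [norm_neg]; exact hm 0 h0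
  have hbp : 0 < 1 - ‖b‖ ^ 2 := by
    rw [norm_neg] at hb1
    nlinarith [norm_nonneg b]
  set G : ℂ → ℂ := fun w => (-b + F w) / (1 + conj (-b) * F w) with hG
  have hGd : DifferentiableOn ℂ G (ball 0 1) :=
    (hF.const_add _).div ((hF.const_mul _).const_add _) fun w hw =>
      one_add_conj_mul_ne_zero hb1 (hm w hw)
  have hG0 : G 0 = 0 := by simp [hG, ← hb]
  have h1 : ‖deriv G 0‖ ≤ 1 := by
    refine Complex.norm_deriv_le_one_of_mapsTo_ball hGd (fun w hw => ?_) one_pos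
    rw [hG0, mem_closedBall_zero_iff]
    exact (norm_mobius_lt_one hb1 (hm w hw)).le
  have hFd : HasDerivAt F (deriv F 0) 0 :=
    (hF.differentiableAt (isOpen_ball.mem_nhds h0)).hasDerivAt
  have hden : 1 + conj (-b) * F 0 = ((1 - ‖b‖ ^ 2 : ℝ) : ℂ) := by
    push_cast
    rw [← hb, ← Complex.conj_mul', map_neg]
    ring
  have hGderiv : HasDerivAt G (deriv F 0 / (1 - ‖b‖ ^ 2 : ℝ)) 0 := by
    have hne : ((1 - ‖b‖ ^ 2 : ℝ) : ℂ) ≠ 0 := by exact_mod_cast hbp.ne'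
    convert! (hFd.const_add (-b)).div ((hFd.const_mul (conj (-b))).const_add 1)
      (by rw [hden]; exact hne) using 1
    rw [hden, ← hb]
    field_simp
    ring
  rw [hGderiv.deriv, norm_div, Complex.norm_real, Real.norm_of_nonneg hbp.le, div_le_one hbp] at h1
  exact h1

open Metric ComplexConjugate in
/-- The Schwarz-Pick estimate on the polydisk. -/
lemma sum_norm_fderiv_mul_le {n : ℕ} {u : (Fin n → ℂ) → ℂ} (hu : HoloOnPolydisk u)
    (hm : ∀ z ∈ polydisk n, ‖u z‖ < 1) {a : Fin n → ℂ} (ha : a ∈ polydisk n) :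
    ∑ k, ‖fderiv ℂ u a (Pi.single k 1)‖ * (1 - ‖a k‖ ^ 2) ≤ 1 - ‖u a‖ ^ 2 := by
  set D := fderiv ℂ u a
  have hv : ∀ k, ∃ v : ℂ, ‖v‖ = 1 ∧ v * D (Pi.single k 1) = ‖D (Pi.single k 1)‖ := fun k => by
    obtain ⟨v, hv1, hv2⟩ := RCLike.exists_norm_eq_mul_self (D (Pi.single k (1 : ℂ)))
    exact ⟨v, hv1, hv2.symm⟩
  choose v hv1 hv2 using hv
  set γ : ℂ → Fin n → ℂ := fun w k => (a k + w * v k) / (1 + conj (a k) * (w * v k)) with hγ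
  have hγ0 : γ 0 = a := by ext k; simp [hγ]
  have hwv : ∀ w ∈ ball (0 : ℂ) 1, ∀ k, ‖w * v k‖ < 1 := fun w hw k => by
    rw [norm_mul, hv1, mul_one]; simpa using hw
  have hγm : MapsTo γ (ball 0 1) (polydisk n) := fun w hw k =>
    norm_mobius_lt_one (ha k) (hwv w hw k)
  have hγd : DifferentiableOn ℂ γ (ball 0 1) := by
    refine differentiableOn_pi.2 fun k => ?_
    refine DifferentiableOn.div (by fun_prop) (by fun_prop) fun w hw =>
      one_add_conj_mul_ne_zero (ha k) (hwv w hw k)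
  have hγ' : HasDerivAt γ (fun k => v k * (1 - ‖a k‖ ^ 2 : ℝ)) 0 :=
    hasDerivAt_pi.2 fun k => hasDerivAt_mobius_zero (a k) (v k)
  have hua : HasFDerivAt u D (γ 0) := by
    rw [hγ0]
    exact (hu.differentiableAt ((isOpen_polydisk n).mem_nhds ha)).hasFDerivAt
  have hF : HasDerivAt (u ∘ γ) (D fun k => v k * (1 - ‖a k‖ ^ 2 : ℝ)) 0 :=
    hua.comp_hasDerivAt 0 hγ'
  have h1 := norm_deriv_zero_le_one_sub_sq (hu.comp hγd hγm) fun w hw => hm _ (hγm hw)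
  rw [hF.deriv] at h1
  have h2 : (D fun k => v k * (1 - ‖a k‖ ^ 2 : ℝ)) =
      ((∑ k, ‖D (Pi.single k 1)‖ * (1 - ‖a k‖ ^ 2) : ℝ) : ℂ) := by
    rw [pi_eq_sum_univ' (fun k => v k * ((1 - ‖a k‖ ^ 2 : ℝ) : ℂ)), map_sum]
    push_cast
    refine Finset.sum_congr rfl fun k _ => ?_
    rw [map_smul, ← hv2, smul_eq_mul]
    ring
  rw [h2, Complex.norm_real] at h1
  simp only [Function.comp, hγ0] at h1
  exact (le_abs_self _).trans h1

/-- Two mutually inverse matrices which are contractive from a weighted sup norm to another one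
have exactly one nonzero entry in each row. -/
lemma exists_perm_of_weighted_contraction {n : ℕ} {A B : Fin n → Fin n → ℂ} {p q : Fin n → ℝ}
    (hp : ∀ k, 0 < p k) (hq : ∀ j, 0 < q j)
    (hA : ∀ j, ∑ k, ‖A j k‖ * p k ≤ q j) (hB : ∀ k, ∑ j, ‖B k j‖ * q j ≤ p k)
    (hBA : ∀ k, ∑ j, B k j * A j k = 1) :
    ∃ σ : Equiv.Perm (Fin n), ∀ j k, A j k ≠ 0 ↔ k = σ j := by
  have hle : ∀ j k, ‖A j k‖ * p k ≤ q j := fun j k =>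
    (Finset.single_le_sum (f := fun k => ‖A j k‖ * p k)
      (fun k _ => mul_nonneg (norm_nonneg _) (hp k).le) (Finset.mem_univ k)).trans (hA j)
  have hex : ∀ k, ∃ j, ‖A j k‖ * p k = q j := by
    intro k
    by_contra hne
    push Not at hne
    have hlt : ∀ j, ‖A j k‖ * p k < q j := fun j => lt_of_le_of_ne (hle j k) (hne j)
    have h1 : p k ≤ ∑ j, ‖B k j‖ * (‖A j k‖ * p k) := by
      have : (1 : ℝ) ≤ ∑ j, ‖B k j‖ * ‖A j k‖ := by
        calc (1 : ℝ) = ‖∑ j, B k j * A j k‖ := by rw [hBA]; simp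
          _ ≤ ∑ j, ‖B k j * A j k‖ := norm_sum_le _ _
          _ = _ := by simp
      simp_rw [← mul_assoc, ← Finset.sum_mul]
      nlinarith [hp k]
    have hBne : ∃ j, B k j ≠ 0 := by
      by_contra h0
      push Not at h0
      have := hBA k
      simp [h0] at this
    obtain ⟨j₀, hj₀⟩ := hBne
    have h2 : ∑ j, ‖B k j‖ * (‖A j k‖ * p k) < ∑ j, ‖B k j‖ * q j :=
      Finset.sum_lt_sum (fun j _ => mul_le_mul_of_nonneg_left (hle j k) (norm_nonneg _))
        ⟨j₀, Finset.mem_univ _, mul_lt_mul_of_pos_left (hlt j₀) (norm_pos_iff.2 hj₀)⟩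
    linarith [hB k]
  choose τ hτ using hex
  have hzero : ∀ k l, l ≠ k → A (τ k) l = 0 := by
    intro k l hl
    have h1 : ‖A (τ k) l‖ * p l + ‖A (τ k) k‖ * p k ≤ q (τ k) := by
      rw [← Finset.sum_pair (f := fun k' => ‖A (τ k) k'‖ * p k') hl]
      exact (Finset.sum_le_sum_of_subset_of_nonneg (Finset.subset_univ _)
        fun k' _ _ => mul_nonneg (norm_nonneg _) (hp k').le).trans (hA _)
    rw [hτ] at h1
    have h2 : ‖A (τ k) l‖ = 0 := by
      have := norm_nonneg (A (τ k) l)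
      have := hp l
      nlinarith
    exact norm_eq_zero.1 h2
  have hne : ∀ k, A (τ k) k ≠ 0 := by
    intro k h0
    have := hτ k
    rw [h0, norm_zero, zero_mul] at this
    exact (hq _).ne this
  have hinj : Function.Injective τ := by
    intro k l hkl
    by_contra hne'
    refine hne k ?_
    rw [hkl]
    exact hzero l k hne'
  let e : Equiv.Perm (Fin n) := Equiv.ofBijective τ (Finite.injective_iff_bijective.1 hinj)
  refine ⟨e.symm, fun j k => ?_⟩
  have hj : τ (e.symm j) = j := e.apply_symm_apply j
  constructor
  · intro h
    by_contra hk
    refine h ?_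
    rw [← hj]
    exact hzero _ _ hk
  · rintro rfl
    have := hne (e.symm j)
    rwa [hj] at this

open Metric Topology in
/-- Partial derivatives of holomorphic functions on the polydisk are continuous. -/
lemma continuousOn_fderiv_apply {n : ℕ} {u : (Fin n → ℂ) → ℂ} (hu : HoloOnPolydisk u)
    (k : Fin n) : ContinuousOn (fun a => fderiv ℂ u a (Pi.single k 1)) (polydisk n) := by
  have hslice : ∀ a ∈ polydisk n, HasDerivAt (fun w : ℂ => u (a + w • Pi.single k 1))
      (fderiv ℂ u a (Pi.single k 1)) 0 := by
    intro a ha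
    have h1 : HasDerivAt (fun w : ℂ => a + w • (Pi.single k 1 : Fin n → ℂ)) (Pi.single k 1) 0 := by
      simpa using ((hasDerivAt_id (0 : ℂ)).smul_const (Pi.single k 1 : Fin n → ℂ)).const_add a
    have h2 : HasFDerivAt u (fderiv ℂ u a) (a + (0 : ℂ) • (Pi.single k 1 : Fin n → ℂ)) := by
      rw [zero_smul, add_zero]
      exact (hu.differentiableAt ((isOpen_polydisk n).mem_nhds ha)).hasFDerivAt
    exact h2.comp_hasDerivAt 0 h1
  intro a ha
  refine ContinuousAt.continuousWithinAt ?_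
  obtain ⟨δ, hδ, hball⟩ := nhds_basis_closedBall.mem_iff.1 ((isOpen_polydisk n).mem_nhds ha)
  have huc := (isCompact_closedBall a δ).uniformContinuousOn_of_continuous
    (hu.continuousOn.mono hball)
  rw [Metric.uniformContinuousOn_iff] at huc
  rw [Metric.continuousAt_iff]
  intro ε hε
  obtain ⟨η, hη, hη'⟩ := huc (ε / 2 * (δ / 2)) (by positivity)
  refine ⟨min η (δ / 2), by positivity, fun {b} hb => ?_⟩
  have hbη : dist b a < η := hb.trans_le (min_le_left _ _)
  have hbδ : dist b a < δ / 2 := hb.trans_le (min_le_right _ _)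
  have hsingle : ∀ w : ℂ, ‖w • (Pi.single k 1 : Fin n → ℂ)‖ = ‖w‖ := fun w => by
    rw [norm_smul, Pi.norm_single, norm_one, mul_one]
  have hmem : ∀ c, dist c a < δ / 2 → ∀ w : ℂ, ‖w‖ ≤ δ / 2 →
      c + w • (Pi.single k 1 : Fin n → ℂ) ∈ closedBall a δ := by
    intro c hc w hw
    rw [mem_closedBall, dist_eq_norm] at *
    calc ‖c + w • (Pi.single k 1 : Fin n → ℂ) - a‖
        = ‖(c - a) + w • (Pi.single k 1 : Fin n → ℂ)‖ := by congr 1; abel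
      _ ≤ ‖c - a‖ + ‖w‖ := (norm_add_le _ _).trans_eq (by rw [hsingle])
      _ ≤ δ := by linarith
  have haa : dist a a < δ / 2 := by rw [dist_self]; positivity
  have hbp : b ∈ polydisk n := hball (mem_closedBall.2 (by linarith))
  have hdc : ∀ c, dist c a < δ / 2 →
      DifferentiableOn ℂ (fun w : ℂ => u (c + w • Pi.single k 1)) (closedBall 0 (δ / 2)) := by
    intro c hc
    refine hu.comp (by fun_prop) fun w hw => hball (hmem c hc w ?_)
    simpa using hw
  have hd := (hslice b hbp).sub (hslice a ha)
  have hdiff : DiffContOnCl ℂ ((fun w : ℂ => u (b + w • Pi.single k 1)) -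
      fun w : ℂ => u (a + w • Pi.single k 1)) (ball 0 (δ / 2)) :=
    ((hdc b hbδ).sub (hdc a haa)).diffContOnCl_ball subset_rfl
  have hest := Complex.norm_deriv_le_of_forall_mem_sphere_norm_le (by positivity) hdiff
    (C := ε / 2 * (δ / 2)) fun w hw => by
      have hw' : ‖w‖ ≤ δ / 2 := by rw [mem_sphere_zero_iff_norm] at hw; exact hw.le
      have := hη' _ (hmem b hbδ w hw') _ (hmem a haa w hw') (by simpa using hbη)
      rw [dist_eq_norm] at this
      exact this.le
  rw [hd.deriv, mul_div_cancel_right₀ _ (by positivity)] at hest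
  rw [dist_eq_norm]
  linarith

open Topology in
/-- The `j`-th component of a polydisk automorphism depends on a single variable `z (σ j)`. -/
theorem exists_perm_of_automorphism {n : ℕ} {φ ψ : (Fin n → ℂ) → Fin n → ℂ}
    (hφm : MapsTo φ (polydisk n) (polydisk n))
    (hφd : ∀ i, DifferentiableOn ℂ (fun z => φ z i) (polydisk n))
    (hψm : MapsTo ψ (polydisk n) (polydisk n))
    (hψd : ∀ i, DifferentiableOn ℂ (fun z => ψ z i) (polydisk n))
    (hφψ : ∀ z ∈ polydisk n, φ (ψ z) = z) :
    ∃ σ : Equiv.Perm (Fin n), ∀ z ∈ polydisk n, ∀ z' ∈ polydisk n, ∀ j,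
      z (σ j) = z' (σ j) → ψ z j = ψ z' j := by
  rcases (polydisk n).eq_empty_or_nonempty with hem | ⟨z₀, hz₀⟩
  · exact ⟨1, by simp [hem]⟩
  have hnb : ∀ z ∈ polydisk n, polydisk n ∈ 𝓝 z := fun z hz => (isOpen_polydisk n).mem_nhds hz
  have hψat : ∀ z ∈ polydisk n, ∀ j, HasFDerivAt (fun z => ψ z j)
      (fderiv ℂ (fun z => ψ z j) z) z := fun z hz j =>
    ((hψd j).differentiableAt (hnb z hz)).hasFDerivAt
  have hφat : ∀ z ∈ polydisk n, ∀ j, HasFDerivAt (fun z => φ z j)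
      (fderiv ℂ (fun z => φ z j) z) z := fun z hz j =>
    ((hφd j).differentiableAt (hnb z hz)).hasFDerivAt
  have hpos : ∀ z ∈ polydisk n, ∀ k, 0 < 1 - ‖z k‖ ^ 2 := fun z hz k => by
    have := hz k
    nlinarith [norm_nonneg (z k)]
  have hsum : ∀ (L : (Fin n → ℂ) →L[ℂ] ℂ) (v : Fin n → ℂ),
      L v = ∑ k, v k * L (Pi.single k 1) := fun L v => by
    conv_lhs => rw [pi_eq_sum_univ' v, map_sum]
    simp
  have hperm : ∀ z, ∃ σ : Equiv.Perm (Fin n), z ∈ polydisk n → ∀ j k,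
      fderiv ℂ (fun z => ψ z j) z (Pi.single k 1) ≠ 0 ↔ k = σ j := by
    intro z
    by_cases hz : z ∈ polydisk n
    swap
    · exact ⟨1, fun h => absurd h hz⟩
    obtain ⟨σ, hσ⟩ := exists_perm_of_weighted_contraction (hpos z hz) (hpos (ψ z) (hψm hz))
      (A := fun j k => fderiv ℂ (fun z => ψ z j) z (Pi.single k 1))
      (B := fun k j => fderiv ℂ (fun z => φ z k) (ψ z) (Pi.single j 1))
      (fun j => sum_norm_fderiv_mul_le (hψd j) (fun w hw => hψm hw j) hz)
      (fun k => by
        have := sum_norm_fderiv_mul_le (hφd k) (fun w hw => hφm hw k) (hψm hz)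
        rwa [hφψ z hz] at this)
      (fun k => by
        have h1 : HasFDerivAt ψ (ContinuousLinearMap.pi fun j => fderiv ℂ (fun z => ψ z j) z) z :=
          hasFDerivAt_pi.2 (hψat z hz)
        have h2 := (hφat _ (hψm hz) k).comp z h1
        have h3 : HasFDerivAt ((fun z => φ z k) ∘ ψ)
            (ContinuousLinearMap.proj (R := ℂ) (φ := fun _ : Fin n => ℂ) k) z := by
          refine (ContinuousLinearMap.hasFDerivAt
            (ContinuousLinearMap.proj (R := ℂ) (φ := fun _ : Fin n => ℂ) k)).congr_of_eventuallyEq ?_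
          filter_upwards [hnb z hz] with w hw
          simp [hφψ w hw]
        have h4 := congrArg (fun L : (Fin n → ℂ) →L[ℂ] ℂ => L (Pi.single k 1)) (h2.unique h3)
        simp only [ContinuousLinearMap.comp_apply] at h4
        rw [hsum] at h4
        simp only [ContinuousLinearMap.pi_apply, ContinuousLinearMap.proj_apply,
          Pi.single_eq_same] at h4
        exact (Finset.sum_congr rfl fun j _ => mul_comm _ _).trans h4)
    exact ⟨σ, fun _ => hσ⟩
  choose σ hσ using hperm
  have hconst : ∀ z ∈ polydisk n, ∀ j, σ z j = σ z₀ j := by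
    intro z hz j
    refine (convex_polydisk n).isPreconnected.constant (f := fun z => σ z j) ?_ hz hz₀
    intro a ha
    have hne := ((hσ a ha) j (σ a j)).2 rfl
    have hc := (continuousOn_fderiv_apply (hψd j) (σ a j)).continuousAt (hnb a ha)
    refine ContinuousAt.continuousWithinAt ?_
    refine (continuousAt_const (y := σ a j)).congr ?_
    filter_upwards [hc.eventually_ne hne, hnb a ha] with b hb hbp
    exact ((hσ b hbp) j (σ a j)).1 hb
  refine ⟨σ z₀, fun z hz z' hz' j hj => ?_⟩
  have hseg : ∀ t ∈ Icc (0 : ℝ) 1, HasDerivWithinAt (fun t : ℝ => ψ (z + t • (z' - z)) j) 0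
      (Icc 0 1) t := by
    intro t ht
    have hmem : z + t • (z' - z) ∈ polydisk n := by
      exact (convex_polydisk n).add_smul_sub_mem hz hz' ht
    have h1 : HasDerivAt (fun t : ℝ => z + t • (z' - z)) (z' - z) t := by
      simpa using ((hasDerivAt_id t).smul_const (z' - z)).const_add z
    have h2 := ((hψat _ hmem j).restrictScalars ℝ).comp_hasDerivAt t h1
    have h3 : (fderiv ℂ (fun z => ψ z j) (z + t • (z' - z))) (z' - z) = 0 := by
      rw [hsum]
      refine Finset.sum_eq_zero fun k _ => ?_
      by_cases hk : k = σ z₀ j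
      · rw [hk, Pi.sub_apply, hj, sub_self, zero_mul]
      · rw [mul_eq_zero]
        right
        by_contra hne
        exact hk (((hσ _ hmem j k).1 hne).trans (hconst _ hmem j))
    rw [ContinuousLinearMap.coe_restrictScalars', h3] at h2
    exact h2.hasDerivWithinAt
  have h := Convex.norm_image_sub_le_of_norm_hasDerivWithin_le (C := 0) hseg (by simp)
    (convex_Icc (0 : ℝ) 1) (left_mem_Icc.2 zero_le_one) (right_mem_Icc.2 zero_le_one)
  simp only [one_smul, zero_smul, add_zero, zero_mul, add_sub_cancel] at h
  exact (sub_eq_zero.1 (norm_le_zero_iff.1 h)).symm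

lemma torusPoint_eq {n : ℕ} (r : ℝ) (θ : Fin n → ℝ) :
    (fun i => (r : ℂ) * Complex.exp (Complex.I * (θ i : ℂ))) = torusPoint r θ := by
  ext i
  simp [torusPoint, circleMap, mul_comm]

lemma toReal_negLog {z : ℂ} (hz : ‖z‖ ≤ 1) : (negLog z).toReal = -Real.log ‖z‖ := by
  unfold negLog
  split_ifs with h
  · simp [h]
  · rw [ENNReal.toReal_ofReal]
    have := Real.log_nonpos (norm_nonneg z) hz
    linarith

lemma ofReal_one_sub_norm_le_negLog (z : ℂ) : ENNReal.ofReal (1 - ‖z‖) ≤ negLog z := by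
  unfold negLog
  split_ifs with h
  · exact le_top
  · refine ENNReal.ofReal_le_ofReal ?_
    have := Real.log_le_sub_one_of_pos (norm_pos_iff.2 h)
    linarith

open Topology in
lemma exists_seq_tendsto_nhdsLT_one {ρ : ℝ} (hρ : ρ < 1) :
    ∃ u : ℕ → ℝ, (∀ k, u k ∈ Ioo ρ 1) ∧ Tendsto u atTop (𝓝[<] 1) := by
  obtain ⟨u, -, hu, hlim⟩ := exists_seq_strictMono_tendsto' hρ
  exact ⟨u, hu, tendsto_nhdsWithin_iff.2 ⟨hlim, Eventually.of_forall fun k => (hu k).2⟩⟩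

lemma measurable_negLog_comp_torusPoint {n : ℕ} {f : (Fin n → ℂ) → ℂ} (hf : HoloOnPolydisk f)
    {r : ℝ} (hr : 0 ≤ r) (hr1 : r < 1) : Measurable fun θ => negLog (f (torusPoint r θ)) :=
  measurable_negLog.comp (continuous_comp_torusPoint hf hr hr1).measurable

lemma measurable_prod_poissonDensity {n : ℕ} (r : ℝ) (z : Fin n → ℂ) :
    Measurable fun θ : Fin n → ℝ => ∏ i, poissonDensity r (z i) (θ i) :=
  Finset.measurable_prod _ fun i _ =>
    (measurable_poissonDensity_right r (z i)).comp (measurable_pi_apply i)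

lemma exists_radius_lt_one {n : ℕ} {z : Fin n → ℂ} (hz : z ∈ polydisk n) :
    ∃ ρ : ℝ, 0 < ρ ∧ ρ < 1 ∧ ∀ i, ‖z i‖ < ρ := by
  have h1 : ‖z‖ < 1 := (pi_norm_lt_iff one_pos).2 hz
  refine ⟨(‖z‖ + 1) / 2, by positivity, by linarith, fun i => ?_⟩
  have := norm_le_pi_norm z i
  linarith

open Topology in
lemma tendsto_prod_poissonDensity {n : ℕ} {z : Fin n → ℂ} (hz : z ∈ polydisk n)
    (θ : Fin n → ℝ) : Tendsto (fun r => ∏ i, poissonDensity r (z i) (θ i)) (𝓝[<] 1)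
      (𝓝 (∏ i, poissonDensity 1 (z i) (θ i))) := by
  obtain ⟨ρ, hρ0, hρ1, hρ⟩ := exists_radius_lt_one hz
  have hpos : ∀ r, ρ < r → ∀ i, 0 ≤ (2 * Real.pi)⁻¹ * poissonKernel 0 (z i) (circleMap 0 r (θ i)) :=
    fun r hr i => mul_nonneg (by positivity) (poissonKernel_nonneg ((hρ i).trans hr).le
      (norm_circleMap_zero_of_pos (hρ0.trans hr).le _))
  have heq : ∀ r, ρ < r → ∏ i, poissonDensity r (z i) (θ i) = ENNReal.ofReal
      (∏ i, ((2 * Real.pi)⁻¹ * poissonKernel 0 (z i) (circleMap 0 r (θ i)))) := fun r hr => by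
    rw [ENNReal.ofReal_prod_of_nonneg fun i _ => hpos r hr i]
    rfl
  rw [heq 1 hρ1]
  have hcont : ContinuousAt (fun r : ℝ =>
      ∏ i, ((2 * Real.pi)⁻¹ * poissonKernel 0 (z i) (circleMap 0 r (θ i)))) 1 := by
    refine tendsto_finsetProd _ fun i _ => ?_
    have hne : ‖circleMap 0 1 (θ i) - 0 - (z i - 0)‖ ^ 2 ≠ 0 := by
      refine pow_ne_zero 2 (norm_ne_zero_iff.2 fun h => ?_)
      have h1 : circleMap 0 1 (θ i) = z i := by linear_combination h
      have h2 := norm_circleMap_zero_of_pos zero_le_one (θ i)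
      rw [h1] at h2
      exact (hz i).ne h2
    have hcm : ContinuousAt (fun r : ℝ => circleMap 0 r (θ i)) 1 := by
      unfold circleMap
      fun_prop
    unfold poissonKernel
    exact ((((hcm.sub_const 0).norm.pow 2).sub_const _).div
      (((hcm.sub_const 0).sub_const _).norm.pow 2) hne).const_mul _
  refine ((ENNReal.continuous_ofReal.tendsto _).comp
    (hcont.tendsto.mono_left nhdsWithin_le_nhds)).congr' ?_
  filter_upwards [nhdsWithin_le_nhds (Ioi_mem_nhds hρ1)] with r hr
  exact (heq r hr).symm

open Topology in
/-- Inner functions are bounded by one. -/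
theorem inBallHinf_of_isInnerFn {n : ℕ} {g : (Fin n → ℂ) → ℂ} (hg : IsInnerFn g) :
    InBallHinf g := by
  obtain ⟨hd, ⟨M₀, hM₀⟩, hlim⟩ := hg
  refine ⟨hd, fun z hz => ?_⟩
  set M := max M₀ 1
  have hM1 : 1 ≤ M := le_max_right _ _
  have hM0 : 0 < M := by linarith
  have hM : ∀ z ∈ polydisk n, ‖g z‖ ≤ M := fun z hz => (hM₀ z hz).trans (le_max_left _ _)
  set h : (Fin n → ℂ) → ℂ := fun z => g z / M with hh
  have hnorm : ∀ z, ‖h z‖ = ‖g z‖ / M := fun z => by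
    rw [hh, norm_div, Complex.norm_real, Real.norm_of_nonneg hM0.le]
  have hball : InBallHinf h := ⟨by
    unfold HoloOnPolydisk at hd ⊢
    simp only [hh, div_eq_mul_inv]
    exact hd.mul_const _, fun z hz => by
    rw [hnorm, div_le_one hM0]; exact hM z hz⟩
  obtain ⟨ρ, hρ0, hρ1, hρ⟩ := exists_radius_lt_one hz
  obtain ⟨u, hu, hulim⟩ := exists_seq_tendsto_nhdsLT_one hρ1
  have hsuper : ∀ k, ∫⁻ θ, (∏ i, poissonDensity (u k) (z i) (θ i)) *
      negLog (h (torusPoint (u k) θ)) ∂boxMeasure n ≤ negLog (h z) := fun k =>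
    lintegral_prod_poissonDensity_mul_negLog_le hball (hρ0.trans (hu k).1) (hu k).2
      fun i => (hρ i).trans (hu k).1
  have hfatou := lintegral_liminf_le (μ := boxMeasure n) (u := atTop)
    (f := fun k θ => (∏ i, poissonDensity (u k) (z i) (θ i)) * negLog (h (torusPoint (u k) θ)))
    fun k => (measurable_prod_poissonDensity _ z).mul (measurable_negLog_comp_torusPoint hball.1
      (hρ0.trans (hu k).1).le (hu k).2)
  have hle : liminf (fun k => ∫⁻ θ, (∏ i, poissonDensity (u k) (z i) (θ i)) *
      negLog (h (torusPoint (u k) θ)) ∂boxMeasure n) atTop ≤ negLog (h z) :=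
    (liminf_le_liminf (Eventually.of_forall hsuper)).trans_eq (by simp)
  have hae : ∀ᵐ θ ∂boxMeasure n, liminf (fun k => (∏ i, poissonDensity (u k) (z i) (θ i)) *
      negLog (h (torusPoint (u k) θ))) atTop =
      (∏ i, poissonDensity 1 (z i) (θ i)) * ENNReal.ofReal (Real.log M) := by
    rw [boxMeasure_eq]
    filter_upwards [ae_restrict_of_ae hlim] with θ hθ
    simp only [torusPoint_eq] at hθ
    refine Tendsto.liminf_eq ?_
    have h1 : Tendsto (fun r => negLog (h (torusPoint r θ))) (𝓝[<] 1)
        (𝓝 (ENNReal.ofReal (Real.log M))) := by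
      have h2 : Tendsto (fun r => ENNReal.ofReal (-Real.log ‖h (torusPoint r θ)‖)) (𝓝[<] 1)
          (𝓝 (ENNReal.ofReal (Real.log M))) := by
        refine (ENNReal.continuous_ofReal.tendsto _).comp ?_
        have h3 := ((hθ.div_const M).log (by positivity)).neg
        rw [one_div, Real.log_inv, neg_neg] at h3
        simpa only [hnorm] using h3
      refine h2.congr' ?_
      filter_upwards [hθ.eventually_ne one_ne_zero] with r hr
      have : h (torusPoint r θ) ≠ 0 := by
        rw [← norm_ne_zero_iff, hnorm]
        positivity
      rw [negLog, if_neg this]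
    refine (ENNReal.Tendsto.mul (tendsto_prod_poissonDensity hz θ) (Or.inr ENNReal.ofReal_ne_top) h1
      (Or.inr ?_)).comp hulim
    exact ENNReal.prod_ne_top fun i _ => ENNReal.ofReal_ne_top
  rw [lintegral_congr_ae hae, lintegral_mul_const _ (measurable_prod_poissonDensity 1 z),
    boxMeasure, lintegral_pi_prod_eq _ fun i => measurable_poissonDensity_right 1 (z i)] at hfatou
  simp only [lintegral_poissonDensity (hz _), Finset.prod_const_one, one_mul] at hfatou
  have hfin := hfatou.trans hle
  unfold negLog at hfin
  split_ifs at hfin with h0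
  · have : g z = 0 := by
      rw [← norm_eq_zero, hnorm, div_eq_zero_iff] at h0
      exact norm_eq_zero.1 (h0.resolve_right hM0.ne')
    rw [this, norm_zero]
    exact zero_le_one
  · have hlog : Real.log ‖h z‖ ≤ 0 := Real.log_nonpos (norm_nonneg _) (hball.2 z hz)
    rw [ENNReal.ofReal_le_ofReal_iff (by linarith)] at hfin
    have hg0 : 0 < ‖g z‖ := by
      have := norm_pos_iff.2 h0
      rw [hnorm] at this
      exact (div_pos_iff_of_pos_right hM0).1 this
    rw [hnorm, Real.log_div hg0.ne' hM0.ne'] at hfin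
    rw [← Real.log_nonpos_iff hg0.le]
    linarith

lemma exists_ne_zero_of_isInnerFn {n : ℕ} {g : (Fin n → ℂ) → ℂ} (hg : IsInnerFn g) :
    ∃ a ∈ polydisk n, g a ≠ 0 := by
  obtain ⟨θ, hθ⟩ := hg.2.2.exists
  simp only [torusPoint_eq] at hθ
  obtain ⟨u, hu, hulim⟩ := exists_seq_tendsto_nhdsLT_one zero_lt_one
  obtain ⟨k, hk⟩ := ((hθ.comp hulim).eventually_ne one_ne_zero).exists
  exact ⟨_, torusPoint_mem_polydisk (hu k).1.le (hu k).2 θ, norm_ne_zero_iff.1 hk⟩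

open Topology in
lemma eventually_lintegral_negLog_ne_top {n : ℕ} {g : (Fin n → ℂ) → ℂ} (hg : InBallHinf g)
    {a : Fin n → ℂ} (ha : a ∈ polydisk n) (hga : g a ≠ 0) :
    ∀ᶠ r in 𝓝[<] (1 : ℝ), ∫⁻ θ, negLog (g (torusPoint r θ)) ∂boxMeasure n ≠ ⊤ := by
  obtain ⟨ρ, hρ0, hρ1, hρ⟩ := exists_radius_lt_one ha
  filter_upwards [Ioo_mem_nhdsLT hρ1] with r hr
  have hr0 : 0 < r := hρ0.trans hr.1
  have har : ∀ i, ‖a i‖ < r := fun i => (hρ i).trans hr.1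
  set c : ENNReal := ∏ i, ENNReal.ofReal ((2 * Real.pi)⁻¹ * ((r - ‖a i‖) / (r + ‖a i‖)))
  have hc : c ≠ 0 := by
    refine Finset.prod_ne_zero_iff.2 fun i _ => ?_
    rw [← pos_iff_ne_zero, ENNReal.ofReal_pos]
    have := sub_pos.2 (har i)
    have := norm_nonneg (a i)
    positivity
  have h1 : c * ∫⁻ θ, negLog (g (torusPoint r θ)) ∂boxMeasure n ≤ negLog (g a) := by
    refine le_trans ?_ (lintegral_prod_poissonDensity_mul_negLog_le hg hr0 hr.2 har)
    rw [← lintegral_const_mul _ (measurable_negLog_comp_torusPoint hg.1 hr0.le hr.2)]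
    refine lintegral_mono fun θ => mul_le_mul_left ?_ _
    refine Finset.prod_le_prod' fun i _ => ENNReal.ofReal_le_ofReal ?_
    exact mul_le_mul_of_nonneg_left (le_poissonKernel (har i)
      (norm_circleMap_zero_of_pos hr0.le _)) (by positivity)
  intro htop
  rw [htop, ENNReal.mul_top hc, negLog, if_neg hga] at h1
  exact absurd h1 (by simp)

lemma setIntegral_log_norm_eq {n : ℕ} {f : (Fin n → ℂ) → ℂ} (hf : InBallHinf f) {r : ℝ}
    (hr : 0 ≤ r) (hr1 : r < 1) (hfin : ∫⁻ θ, negLog (f (torusPoint r θ)) ∂boxMeasure n ≠ ⊤) :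
    ∫ θ in Set.pi univ (fun _ : Fin n => Ico (0 : ℝ) (2 * Real.pi)), Real.log ‖f (torusPoint r θ)‖ =
      -(∫⁻ θ, negLog (f (torusPoint r θ)) ∂boxMeasure n).toReal := by
  have hm := measurable_negLog_comp_torusPoint hf.1 hr hr1
  rw [← boxMeasure_eq, ← integral_toReal hm.aemeasurable (ae_lt_top hm hfin), ← integral_neg]
  refine integral_congr_ae (Eventually.of_forall fun θ => ?_)
  simp only [toReal_negLog (hf.2 _ (torusPoint_mem_polydisk hr hr1 θ)), neg_neg]

open Topology in
lemma tendsto_lintegral_negLog_of_isGoodInnerFn {n : ℕ} {g : (Fin n → ℂ) → ℂ}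
    (hg : IsGoodInnerFn g) :
    Tendsto (fun r => ∫⁻ θ, negLog (g (torusPoint r θ)) ∂boxMeasure n) (𝓝[<] 1) (𝓝 0) := by
  have hb := inBallHinf_of_isInnerFn hg.1
  obtain ⟨a, ha, hga⟩ := exists_ne_zero_of_isInnerFn hg.1
  have hfin := eventually_lintegral_negLog_ne_top hb ha hga
  have h1 := hg.2.const_mul (-((2 * Real.pi) ^ n))
  simp only [torusPoint_eq, mul_zero] at h1
  have h2 := (ENNReal.continuous_ofReal.tendsto _).comp h1
  rw [ENNReal.ofReal_zero] at h2
  refine h2.congr' ?_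
  filter_upwards [hfin, Ioo_mem_nhdsLT zero_lt_one] with r hr hr01
  simp only [Function.comp]
  rw [setIntegral_log_norm_eq hb hr01.1.le hr01.2 hr, inv_pow, ← mul_assoc, neg_mul,
    mul_inv_cancel₀ (by positivity), neg_one_mul, neg_neg, ENNReal.ofReal_toReal hr]

open Topology in
lemma tendsto_integral_log_of_tendsto_lintegral {n : ℕ} {f : (Fin n → ℂ) → ℂ}
    (hf : InBallHinf f)
    (h : Tendsto (fun r => ∫⁻ θ, negLog (f (torusPoint r θ)) ∂boxMeasure n) (𝓝[<] 1) (𝓝 0)) :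
    Tendsto (fun r : ℝ => (2 * Real.pi)⁻¹ ^ n *
        ∫ θ in Set.pi univ (fun _ : Fin n => Ico (0 : ℝ) (2 * Real.pi)),
          Real.log ‖f (torusPoint r θ)‖) (𝓝[<] 1) (𝓝 0) := by
  have h1 := (((ENNReal.tendsto_toReal ENNReal.zero_ne_top).comp h).neg).const_mul
    ((2 * Real.pi)⁻¹ ^ n)
  rw [ENNReal.toReal_zero, neg_zero, mul_zero] at h1
  refine h1.congr' ?_
  filter_upwards [h.eventually_ne ENNReal.zero_ne_top, Ioo_mem_nhdsLT zero_lt_one] with r hr hr01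
  rw [setIntegral_log_norm_eq hf hr01.1.le hr01.2 hr]
  rfl

lemma ae_of_ae_boxMeasure {n : ℕ} {p : (Fin n → ℝ) → Prop}
    (hp : ∀ (θ : Fin n → ℝ) (k : Fin n → ℤ), p (fun i => θ i + k i • (2 * Real.pi)) → p θ)
    (h : ∀ᵐ θ ∂boxMeasure n, p θ) : ∀ᵐ θ : Fin n → ℝ, p θ := by
  rw [boxMeasure_eq, ae_restrict_iff' (MeasurableSet.univ_pi fun _ => measurableSet_Ico)] at h
  have h2 : ∀ k : Fin n → ℤ, ∀ᵐ θ : Fin n → ℝ,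
      (θ + fun i => k i • (2 * Real.pi)) ∈ Set.pi univ (fun _ : Fin n => Ico (0 : ℝ) (2 * Real.pi)) →
        p (θ + fun i => k i • (2 * Real.pi)) := fun k =>
    (measurePreserving_add_right volume
      (fun i : Fin n => k i • (2 * Real.pi))).quasiMeasurePreserving.ae h
  filter_upwards [ae_all_iff.2 h2] with θ hθ
  choose k hk _ using fun i => existsUnique_add_zsmul_mem_Ico Real.two_pi_pos (θ i) 0
  refine hp θ k (hθ k fun i _ => ?_)
  simpa using hk i

open Topology in
theorem ae_tendsto_norm_of_tendsto_lintegral {n : ℕ} {f : (Fin n → ℂ) → ℂ}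
    (hf : InBallHinf f)
    (h : Tendsto (fun r => ∫⁻ θ, negLog (f (torusPoint r θ)) ∂boxMeasure n) (𝓝[<] 1) (𝓝 0)) :
    ∀ᵐ θ : Fin n → ℝ, Tendsto (fun r => ‖f (torusPoint r θ)‖) (𝓝[<] 1) (𝓝 1) := by
  refine ae_of_ae_boxMeasure (fun θ k hk => ?_) ?_
  · have : ∀ r, torusPoint r (fun i => θ i + k i • (2 * Real.pi)) = torusPoint r θ := fun r => by
      ext i
      exact ((periodic_circleMap 0 r).zsmul (k i)) (θ i)
    simpa only [this] using hk
  obtain ⟨u, hu, hulim⟩ := exists_seq_tendsto_nhdsLT_one zero_lt_one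
  have hmeas : ∀ k, Measurable fun θ => negLog (f (torusPoint (u k) θ)) := fun k =>
    measurable_negLog_comp_torusPoint hf.1 (hu k).1.le (hu k).2
  have hfatou := lintegral_liminf_le (μ := boxMeasure n) (u := atTop) hmeas
  replace hfatou := hfatou.trans_eq (h.comp hulim).liminf_eq
  rw [nonpos_iff_eq_zero, lintegral_eq_zero_iff (Measurable.liminf hmeas)] at hfatou
  have hrad := ae_exists_tendsto_torusPoint hf.1 hf.2
  rw [boxMeasure_eq] at hfatou ⊢
  filter_upwards [hfatou, ae_restrict_of_ae hrad] with θ hθ hl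
  obtain ⟨l, hl⟩ := hl
  have h1 : Tendsto (fun k => ENNReal.ofReal (1 - ‖f (torusPoint (u k) θ)‖)) atTop
      (𝓝 (ENNReal.ofReal (1 - ‖l‖))) :=
    (ENNReal.continuous_ofReal.tendsto _).comp ((hl.comp hulim).norm.const_sub 1)
  have h2 : ENNReal.ofReal (1 - ‖l‖) ≤ 0 := by
    rw [← h1.liminf_eq]
    refine le_trans (liminf_le_liminf (Eventually.of_forall fun k => ?_)) hθ.le
    exact ofReal_one_sub_norm_le_negLog _
  have h3 : 1 ≤ ‖l‖ := by
    rw [nonpos_iff_eq_zero, ENNReal.ofReal_eq_zero] at h2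
    linarith
  have h4 : ‖l‖ ≤ 1 := by
    refine le_of_tendsto hl.norm ?_
    filter_upwards [Ioo_mem_nhdsLT zero_lt_one] with r hr
    exact hf.2 _ (torusPoint_mem_polydisk hr.1.le hr.2 θ)
  simpa only [le_antisymm h4 h3] using hl.norm

lemma measurable_poissonDensity_comp {α : Type*} [MeasurableSpace α] {u : α → ℂ} {v : α → ℝ}
    (hu : Measurable u) (r : ℝ) (hv : Measurable v) :
    Measurable fun x => poissonDensity r (u x) (v x) := by
  unfold poissonDensity poissonKernel
  have : Measurable fun x => circleMap 0 r (v x) := by fun_prop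
  fun_prop

open Metric in
/-- Comparison of the logarithmic means of `f` and of `f ∘ ψ`, where each component of `ψ` depends
on a single variable. -/
theorem mul_lintegral_negLog_le {n : ℕ} {f : (Fin n → ℂ) → ℂ} (hf : InBallHinf f)
    {ψ : (Fin n → ℂ) → Fin n → ℂ} {h : Fin n → ℂ → ℂ} {σ : Equiv.Perm (Fin n)}
    (hψ : ∀ z ∈ polydisk n, ∀ j, ψ z j = h j (z (σ j)))
    (hh : ∀ j, DifferentiableOn ℂ (h j) (ball 0 1)) {ρ r : ℝ} (hρ0 : 0 < ρ) (hρ1 : ρ < 1)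
    (hr0 : 0 < r) (hr1 : r < 1) (hr : ∀ j, (1 + ‖h j 0‖) / 2 ≤ r)
    (hhr : ∀ j, ∀ w ∈ closedBall (0 : ℂ) ρ, ‖h j w‖ < r) :
    (∏ j, ENNReal.ofReal ((1 - ‖h j 0‖) / 4)) *
        ∫⁻ η, negLog (f (torusPoint r η)) ∂boxMeasure n ≤
      ∫⁻ ζ, negLog (f (ψ (torusPoint ρ ζ))) ∂boxMeasure n := by
  have hcirc : ∀ t, circleMap 0 ρ t ∈ closedBall (0 : ℂ) ρ := fun t => by
    rw [mem_closedBall_zero_iff, norm_circleMap_zero_of_pos hρ0.le]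
  have hψt : ∀ ζ j, ψ (torusPoint ρ ζ) j = h j (circleMap 0 ρ (ζ (σ j))) := fun ζ j =>
    hψ _ (torusPoint_mem_polydisk hρ0.le hρ1 ζ) j
  have hhc : ∀ j, Continuous fun t => h j (circleMap 0 ρ t) := fun j =>
    (hh j).continuousOn.comp_continuous (continuous_circleMap 0 ρ) fun t =>
      closedBall_subset_ball hρ1 (hcirc t)
  have hsuper : ∀ ζ, ∫⁻ η, (∏ j, poissonDensity r (h j (circleMap 0 ρ (ζ (σ j)))) (η j)) *
      negLog (f (torusPoint r η)) ∂boxMeasure n ≤ negLog (f (ψ (torusPoint ρ ζ))) := fun ζ => by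
    have := lintegral_prod_poissonDensity_mul_negLog_le hf hr0 hr1 (z := ψ (torusPoint ρ ζ))
      fun j => by rw [hψt]; exact hhr j _ (hcirc _)
    simpa only [hψt] using this
  have hPm : ∀ j, Measurable fun p : (Fin n → ℝ) × (Fin n → ℝ) =>
      poissonDensity r (h j (circleMap 0 ρ (p.1 (σ j)))) (p.2 j) := fun j => by
    have h1 : Measurable fun p : (Fin n → ℝ) × (Fin n → ℝ) => h j (circleMap 0 ρ (p.1 (σ j))) :=
      (hhc j).measurable.comp ((measurable_pi_apply (σ j)).comp measurable_fst)
    exact measurable_poissonDensity_comp h1 r ((measurable_pi_apply j).comp measurable_snd)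
  have hNm := measurable_negLog_comp_torusPoint hf.1 hr0.le hr1
  have hprodm : Measurable fun p : (Fin n → ℝ) × (Fin n → ℝ) =>
      (∏ j, poissonDensity r (h j (circleMap 0 ρ (p.1 (σ j)))) (p.2 j)) :=
    Finset.measurable_prod _ fun j _ => hPm j
  have hinner : ∀ η : Fin n → ℝ, ∏ j, ENNReal.ofReal ((1 - ‖h j 0‖) / 4) ≤
      ∫⁻ ζ, ∏ j, poissonDensity r (h j (circleMap 0 ρ (ζ (σ j)))) (η j) ∂boxMeasure n := by
    intro η
    have hre : ∀ ζ : Fin n → ℝ, ∏ j, poissonDensity r (h j (circleMap 0 ρ (ζ (σ j)))) (η j) =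
        ∏ k, poissonDensity r (h (σ.symm k) (circleMap 0 ρ (ζ k))) (η (σ.symm k)) := fun ζ => by
      rw [← Equiv.prod_comp σ fun k =>
        poissonDensity r (h (σ.symm k) (circleMap 0 ρ (ζ k))) (η (σ.symm k))]
      simp only [Equiv.symm_apply_apply]
    have hm : ∀ k, Measurable fun s =>
        poissonDensity r (h (σ.symm k) (circleMap 0 ρ s)) (η (σ.symm k)) := fun k =>
      measurable_poissonDensity_comp (hhc _).measurable r measurable_const
    simp only [hre]
    rw [boxMeasure, lintegral_pi_prod_eq _ hm,
      ← Equiv.prod_comp σ.symm fun j => ENNReal.ofReal ((1 - ‖h j 0‖) / 4)]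
    exact Finset.prod_le_prod' fun k _ =>
      le_lintegral_poissonDensity_comp hρ0 hρ1 (hh _) (hhr _) (hr _) hr1 _
  calc (∏ j, ENNReal.ofReal ((1 - ‖h j 0‖) / 4)) *
        ∫⁻ η, negLog (f (torusPoint r η)) ∂boxMeasure n
      = ∫⁻ η, (∏ j, ENNReal.ofReal ((1 - ‖h j 0‖) / 4)) *
          negLog (f (torusPoint r η)) ∂boxMeasure n := (lintegral_const_mul _ hNm).symm
    _ ≤ ∫⁻ η, (∫⁻ ζ, ∏ j, poissonDensity r (h j (circleMap 0 ρ (ζ (σ j)))) (η j) ∂boxMeasure n) *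
          negLog (f (torusPoint r η)) ∂boxMeasure n :=
        lintegral_mono fun η => mul_le_mul_left (hinner η) _
    _ = ∫⁻ η, ∫⁻ ζ, (∏ j, poissonDensity r (h j (circleMap 0 ρ (ζ (σ j)))) (η j)) *
          negLog (f (torusPoint r η)) ∂boxMeasure n ∂boxMeasure n :=
        lintegral_congr fun η =>
          (lintegral_mul_const _ (hprodm.comp measurable_prodMk_right)).symm
    _ = ∫⁻ ζ, ∫⁻ η, (∏ j, poissonDensity r (h j (circleMap 0 ρ (ζ (σ j)))) (η j)) *
          negLog (f (torusPoint r η)) ∂boxMeasure n ∂boxMeasure n :=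
        (lintegral_lintegral_swap (hprodm.mul (hNm.comp measurable_snd)).aemeasurable).symm
    _ ≤ ∫⁻ ζ, negLog (f (ψ (torusPoint ρ ζ))) ∂boxMeasure n := lintegral_mono hsuper

open Metric Topology in
theorem tendsto_lintegral_negLog_of_comp {n : ℕ} {f : (Fin n → ℂ) → ℂ} (hf : InBallHinf f)
    {ψ : (Fin n → ℂ) → Fin n → ℂ} {h : Fin n → ℂ → ℂ} {σ : Equiv.Perm (Fin n)}
    (hψ : ∀ z ∈ polydisk n, ∀ j, ψ z j = h j (z (σ j)))
    (hh : ∀ j, DifferentiableOn ℂ (h j) (ball 0 1)) (hh1 : ∀ j, ∀ w ∈ ball (0 : ℂ) 1, ‖h j w‖ < 1)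
    (hlim : Tendsto (fun r => ∫⁻ θ, negLog (f (ψ (torusPoint r θ))) ∂boxMeasure n) (𝓝[<] 1)
      (𝓝 0)) :
    Tendsto (fun r => ∫⁻ θ, negLog (f (torusPoint r θ)) ∂boxMeasure n) (𝓝[<] 1) (𝓝 0) := by
  set C : ENNReal := ∏ j, ENNReal.ofReal ((1 - ‖h j 0‖) / 4)
  have hC0 : C ≠ 0 := by
    refine Finset.prod_ne_zero_iff.2 fun j _ => ?_
    rw [← pos_iff_ne_zero, ENNReal.ofReal_pos]
    have := hh1 j 0 (mem_ball_self one_pos)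
    linarith
  have hCt : C ≠ ⊤ := ENNReal.prod_ne_top fun j _ => ENNReal.ofReal_ne_top
  rw [ENNReal.tendsto_nhds_zero] at hlim ⊢
  intro ε hε
  rcases eq_or_ne ε ⊤ with rfl | hεt
  · exact Eventually.of_forall fun _ => le_top
  obtain ⟨ρ, hρ, hρ01⟩ := ((hlim (C * ε) (ENNReal.mul_pos hC0 hε.ne')).and
    (Ioo_mem_nhdsLT zero_lt_one)).exists
  have hev : ∀ j, ∀ᶠ r in 𝓝[<] (1 : ℝ), (1 + ‖h j 0‖) / 2 ≤ r ∧
      ∀ w ∈ closedBall (0 : ℂ) ρ, ‖h j w‖ < r := by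
    intro j
    obtain ⟨w₀, hw₀, hmax⟩ := (isCompact_closedBall (0 : ℂ) ρ).exists_isMaxOn
      ⟨0, mem_closedBall_self hρ01.1.le⟩
      ((hh j).continuousOn.norm.mono (closedBall_subset_ball hρ01.2))
    have h0 := hh1 j 0 (mem_ball_self one_pos)
    filter_upwards [Ioo_mem_nhdsLT (hh1 j w₀ (closedBall_subset_ball hρ01.2 hw₀)),
      Ioo_mem_nhdsLT (show (1 + ‖h j 0‖) / 2 < 1 by linarith)] with r hr1 hr2
    exact ⟨hr2.1.le, fun w hw => (hmax hw).trans_lt hr1.1⟩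
  filter_upwards [eventually_all.2 hev, Ioo_mem_nhdsLT zero_lt_one] with r hr hr01
  have h1 := (mul_lintegral_negLog_le hf hψ hh hρ01.1 hρ01.2 hr01.1 hr01.2
    (fun j => (hr j).1) fun j => (hr j).2).trans hρ
  exact (ENNReal.mul_le_mul_iff_right hC0 hCt).1 h1

/-- composition of a good inner function with a polydisk automorphism
is again a good inner function. -/
theorem goodInner_comp_automorphism {n : ℕ} (g : (Fin n → ℂ) → ℂ)
    (φ : (Fin n → ℂ) → (Fin n → ℂ)) (hg : IsGoodInnerFn g)
    (hφ : IsPolydiskAutomorphism φ) : IsGoodInnerFn (g ∘ φ) := by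
  obtain ⟨hφm, hφd, ψ, hψm, hψd, -, hφψ⟩ := hφ
  obtain ⟨σ, hσ⟩ := exists_perm_of_automorphism hφm hφd hψm hψd hφψ
  have hgb := inBallHinf_of_isInnerFn hg.1
  have hf : InBallHinf (g ∘ φ) :=
    ⟨hgb.1.comp (differentiableOn_pi.2 hφd) hφm, fun z hz => hgb.2 _ (hφm hz)⟩
  have hdiag : ∀ w ∈ Metric.ball (0 : ℂ) 1, (fun _ => w) ∈ polydisk n := fun w hw _ => by
    simpa using hw
  have hlim : Tendsto (fun r => ∫⁻ θ, negLog ((g ∘ φ) (torusPoint r θ)) ∂boxMeasure n)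
      (nhdsWithin 1 (Iio 1)) (nhds 0) := by
    refine tendsto_lintegral_negLog_of_comp hf (ψ := ψ) (h := fun j w => ψ (fun _ => w) j) (σ := σ)
      (fun z hz j => hσ _ hz _ (fun _ => hz _) j rfl)
      (fun j => (hψd j).comp (by fun_prop) hdiag) (fun j w hw => hψm (hdiag w hw) j) ?_
    refine (tendsto_lintegral_negLog_of_isGoodInnerFn hg).congr' ?_
    filter_upwards [Ioo_mem_nhdsLT zero_lt_one] with r hr
    refine lintegral_congr fun θ => ?_
    rw [Function.comp, hφψ _ (torusPoint_mem_polydisk hr.1.le hr.2 θ)]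
  refine ⟨⟨hf.1, ⟨1, hf.2⟩, ?_⟩, ?_⟩
  · simpa only [torusPoint_eq] using ae_tendsto_norm_of_tendsto_lintegral hf hlim
  · simpa only [torusPoint_eq] using tendsto_integral_log_of_tendsto_lintegral hf hlim
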